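/- arXiv:2407.20726 — 4 statements merged into one kernel-verified Lean document; each statement's English description precedes it below -/
import Mathlib

section
/- Let X be a sub-Gaussian random vector in ℝ^d whose function A(h) = |h|²/2 − log E exp(⟨h,X⟩) satisfies A(h) ≥ 0 for all h ∈ ℝ^d. Then the gradient of A satisfies |∇A(h)|² ≤ 2 A(h) for every h ∈ ℝ^d. -/
open MeasureTheory ProbabilityTheory Real Filter
open scoped ENNReal RealInnerProductSpace Topology

/-- A probability distribution on `ℝ^d` is sub-Gaussian if `E exp(c|X|²) < ∞` for some `c > 0`. -/
def IsSubGaussian {d : ℕ} (μ : Measure (EuclideanSpace ℝ (Fin d))) : Prop :=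
  ∃ c > 0, Integrable (fun x => Real.exp (c * ‖x‖ ^ 2)) μ

/-- The log-Laplace transform `K(t) = log ∫ e^{⟨t,x⟩} dμ(x)`. -/
noncomputable def Kfun {d : ℕ} (μ : Measure (EuclideanSpace ℝ (Fin d)))
    (t : EuclideanSpace ℝ (Fin d)) : ℝ :=
  Real.log (∫ x, Real.exp ⟪t, x⟫ ∂μ)

/-- The function `A(t) = |t|²/2 - K(t)`. -/
noncomputable def Afun {d : ℕ} (μ : Measure (EuclideanSpace ℝ (Fin d)))
    (t : EuclideanSpace ℝ (Fin d)) : ℝ :=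
  ‖t‖ ^ 2 / 2 - Kfun μ t

/-- Linear exponential moments of a sub-Gaussian distribution are finite. -/
theorem IsSubGaussian.integrable_exp_inner {d : ℕ}
    {μ : Measure (EuclideanSpace ℝ (Fin d))} (hsub : IsSubGaussian μ)
    (t : EuclideanSpace ℝ (Fin d)) :
    Integrable (fun x => Real.exp ⟪t, x⟫) μ := by
  obtain ⟨c, hc, hint⟩ := hsub
  refine (hint.const_mul (Real.exp (‖t‖ ^ 2 / (4 * c)))).mono' (by fun_prop) ?_
  refine Eventually.of_forall fun x => ?_
  rw [Real.norm_eq_abs, Real.abs_exp, ← Real.exp_add]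
  gcongr
  have h1 : ‖t‖ ^ 2 / (4 * c) + c * ‖x‖ ^ 2 - ‖t‖ * ‖x‖
      = (‖t‖ - 2 * c * ‖x‖) ^ 2 / (4 * c) := by
    field_simp
    ring
  have h2 : 0 ≤ (‖t‖ - 2 * c * ‖x‖) ^ 2 / (4 * c) := by positivity
  linarith [real_inner_le_norm t x]

theorem IsSubGaussian.exp_Kfun {d : ℕ}
    {μ : Measure (EuclideanSpace ℝ (Fin d))} [NeZero μ] (hsub : IsSubGaussian μ)
    (t : EuclideanSpace ℝ (Fin d)) :
    Real.exp (Kfun μ t) = ∫ x, Real.exp ⟪t, x⟫ ∂μ :=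
  Real.exp_log (integral_exp_pos (hsub.integrable_exp_inner t))

/-- The log-Laplace transform of a sub-Gaussian distribution is convex. -/
theorem IsSubGaussian.convexOn_Kfun {d : ℕ}
    {μ : Measure (EuclideanSpace ℝ (Fin d))} [NeZero μ] (hsub : IsSubGaussian μ) :
    ConvexOn ℝ Set.univ (Kfun μ) := by
  refine ⟨convex_univ, fun t _ u _ a b ha hb hab => ?_⟩
  simp only [smul_eq_mul]
  set m := a * Kfun μ t + b * Kfun μ u with hm
  have hpt (x : EuclideanSpace ℝ (Fin d)) : Real.exp ⟪a • t + b • u, x⟫ ≤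
      Real.exp m * (a * (Real.exp (-Kfun μ t) * Real.exp ⟪t, x⟫)
        + b * (Real.exp (-Kfun μ u) * Real.exp ⟪u, x⟫)) := by
    have h := convexOn_exp.2 (Set.mem_univ (-Kfun μ t + ⟪t, x⟫))
      (Set.mem_univ (-Kfun μ u + ⟪u, x⟫)) ha hb hab
    simp only [smul_eq_mul] at h
    rw [← Real.exp_add, ← Real.exp_add]
    calc Real.exp ⟪a • t + b • u, x⟫
        = Real.exp m * Real.exp (a * (-Kfun μ t + ⟪t, x⟫) + b * (-Kfun μ u + ⟪u, x⟫)) := by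
          rw [← Real.exp_add, inner_add_left, real_inner_smul_left, real_inner_smul_left, hm]
          ring_nf
      _ ≤ _ := by gcongr
  have ht := ((hsub.integrable_exp_inner t).const_mul (Real.exp (-Kfun μ t))).const_mul a
  have hu := ((hsub.integrable_exp_inner u).const_mul (Real.exp (-Kfun μ u))).const_mul b
  have hle := integral_mono (hsub.integrable_exp_inner (a • t + b • u))
    ((ht.add hu).const_mul (Real.exp m)) hpt
  simp only [Pi.add_apply] at hle
  rw [integral_const_mul, integral_add ht hu] at hle
  simp only [integral_const_mul, ← hsub.exp_Kfun] at hle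
  simp only [← Real.exp_add, neg_add_cancel, Real.exp_zero, mul_one, hab] at hle
  exact Real.exp_le_exp.1 hle

/-- First-order characterisation of convexity: the tangent plane lies below the graph. -/
theorem ConvexOn.add_fderiv_le {E : Type*} [NormedAddCommGroup E] [NormedSpace ℝ E]
    {f : E → ℝ} (hf : ConvexOn ℝ Set.univ f) {f' : E →L[ℝ] ℝ} {x : E}
    (hx : HasFDerivAt f f' x) (v : E) : f x + f' v ≤ f (x + v) := by
  have hconv : ConvexOn ℝ Set.univ (f ∘ AffineMap.lineMap (k := ℝ) x (x + v)) := by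
    simpa using hf.comp_affineMap (AffineMap.lineMap (k := ℝ) x (x + v))
  have hderiv : HasDerivAt (f ∘ AffineMap.lineMap (k := ℝ) x (x + v)) (f' v) 0 := by
    have hline := AffineMap.hasDerivAt_lineMap (a := x) (b := x + v) (x := (0 : ℝ))
    rw [add_sub_cancel_left] at hline
    exact HasFDerivAt.comp_hasDerivAt (0 : ℝ) (by simpa using hx) hline
  have h := hconv.le_slope_of_hasDerivAt (Set.mem_univ 0) (Set.mem_univ 1) one_pos hderiv
  simp [slope_def_field] at h
  linarith

theorem stmt6 {d : ℕ} (hd : 1 ≤ d)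
    (μ : Measure (EuclideanSpace ℝ (Fin d))) [IsProbabilityMeasure μ]
    (hsub : IsSubGaussian μ)
    (hA : ∀ h, 0 ≤ Afun μ h)
    (h : EuclideanSpace ℝ (Fin d)) :
    ‖gradient (Afun μ) h‖ ^ 2 ≤ 2 * Afun μ h := by
  by_cases hdiff : DifferentiableAt ℝ (Afun μ) h
  · set g := gradient (Afun μ) h with hg
    have hgrad : HasFDerivAt (Afun μ) (InnerProductSpace.toDual ℝ _ g) h :=
      hdiff.hasGradientAt.hasFDerivAt
    have hK : HasFDerivAt (Kfun μ)
        ((2⁻¹ : ℝ) • (2 • innerSL ℝ h) - InnerProductSpace.toDual ℝ _ g) h := by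
      refine (((hasStrictFDerivAt_norm_sq h).hasFDerivAt.const_mul (2⁻¹ : ℝ)).sub
        hgrad).congr_of_eventuallyEq (Eventually.of_forall fun t => ?_)
      simp only [Afun, Pi.sub_apply]
      ring
    have hle := hsub.convexOn_Kfun.add_fderiv_le hK (-g)
    have hnn := hA (h + -g)
    have hnorm := norm_add_sq_real h (-g)
    simp [Afun] at hle hnn hnorm ⊢
    linarith
  · rw [gradient_eq_zero_of_not_differentiableAt hdiff]
    simpa using hA h
end

section
/- For every dimension d there is a constant C_d > 0 with the following property. Let X be a sub-Gaussian random vector in ℝ^d whose function A(h) = |h|²/2 − K(h), K(h) = log E exp(⟨h,X⟩), satisfies A(h) ≥ 0 for all h ∈ ℝ^d. Then for every h with 0 ≤ A(h) ≤ 1: inf_{|θ|=1} ⟨A''(h)θ, θ⟩ ≥ −C_d · A(h)^{1/4}, where A'' is the Hessian of A. -/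
open MeasureTheory ProbabilityTheory Real Filter
open scoped ENNReal RealInnerProductSpace Topology

namespace IsSubGaussian

variable {d : ℕ} {μ : Measure (EuclideanSpace ℝ (Fin d))}

lemma integrable_exp_mul_norm (hμ : IsSubGaussian μ) (a : ℝ) :
    Integrable (fun x => Real.exp (a * ‖x‖)) μ := by
  obtain ⟨c, hc, hint⟩ := hμ
  refine (hint.const_mul (Real.exp (a ^ 2 / (4 * c)))).mono' (by fun_prop) (.of_forall fun x => ?_)
  rw [Real.norm_eq_abs, abs_of_pos (Real.exp_pos _), ← Real.exp_add]
  refine Real.exp_le_exp.2 ?_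
  have key : a ^ 2 / (4 * c) + c * ‖x‖ ^ 2 - a * ‖x‖ = (a - 2 * c * ‖x‖) ^ 2 / (4 * c) := by
    field_simp
    ring
  have : 0 ≤ (a - 2 * c * ‖x‖) ^ 2 / (4 * c) := by positivity
  linarith

lemma integrable_exp_inner_s12 (hμ : IsSubGaussian μ) (t : EuclideanSpace ℝ (Fin d)) :
    Integrable (fun x => Real.exp ⟪t, x⟫) μ := by
  refine (hμ.integrable_exp_mul_norm ‖t‖).mono' (by fun_prop) (.of_forall fun x => ?_)
  rw [Real.norm_eq_abs, abs_of_pos (Real.exp_pos _)]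
  exact Real.exp_le_exp.2 (real_inner_le_norm t x)

lemma differentiable_integral_exp_inner (hμ : IsSubGaussian μ) :
    Differentiable ℝ (fun t => ∫ x, Real.exp ⟪t, x⟫ ∂μ) := by
  intro t₀
  refine (hasFDerivAt_integral_of_dominated_of_fderiv_le (𝕜 := ℝ)
    (F' := fun t x => Real.exp ⟪t, x⟫ • innerSL ℝ x)
    (bound := fun x => Real.exp ((‖t₀‖ + 2) * ‖x‖))
    (Metric.ball_mem_nhds t₀ one_pos) (.of_forall fun t => by fun_prop)
    (hμ.integrable_exp_inner_s12 t₀) (by fun_prop) (.of_forall fun x t ht => ?_)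
    (hμ.integrable_exp_mul_norm _) (.of_forall fun x t _ => ?_)).differentiableAt
  · have ht' : ‖t‖ ≤ ‖t₀‖ + 1 := by
      have h1 := norm_le_norm_add_norm_sub' t t₀
      have h2 := mem_ball_iff_norm.1 ht
      linarith
    rw [norm_smul, innerSL_apply_norm, Real.norm_eq_abs, abs_of_pos (Real.exp_pos _)]
    calc Real.exp ⟪t, x⟫ * ‖x‖ ≤ Real.exp ((‖t₀‖ + 1) * ‖x‖) * Real.exp ‖x‖ := by
          gcongr
          · exact (real_inner_le_norm t x).trans (by gcongr)
          · linarith [Real.add_one_le_exp ‖x‖]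
      _ = Real.exp ((‖t₀‖ + 2) * ‖x‖) := by
          rw [← Real.exp_add]
          ring_nf
  · have h : HasFDerivAt (fun t : EuclideanSpace ℝ (Fin d) => ⟪t, x⟫) (innerSL ℝ x) t := by
      simpa [real_inner_comm] using (innerSL ℝ x).hasFDerivAt (x := t)
    exact h.exp

lemma differentiable_Afun [IsProbabilityMeasure μ] (hμ : IsSubGaussian μ) :
    Differentiable ℝ (Afun μ) := by
  have hK : Differentiable ℝ (Kfun μ) := fun t =>
    (hμ.differentiable_integral_exp_inner t).log (integral_exp_pos (hμ.integrable_exp_inner_s12 t)).ne'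
  have hN : Differentiable ℝ (fun t : EuclideanSpace ℝ (Fin d) => ‖t‖ ^ 2 / 2) := by
    simpa only [div_eq_mul_inv] using (differentiable_fun_id.norm_sq ℝ).mul_const (2⁻¹ : ℝ)
  exact hN.sub hK

end IsSubGaussian

/-- The second derivative along a line through `x` in direction `v` is the Hessian at `(v, v)`. -/
lemma iteratedDeriv_two_comp_line {E : Type*} [NormedAddCommGroup E] [NormedSpace ℝ E]
    {f : E → ℝ} (hf : Differentiable ℝ f) {x : E} (hf' : DifferentiableAt ℝ (fderiv ℝ f) x)
    (v : E) :
    iteratedDeriv 2 (fun s : ℝ => f (x + s • v)) 0 = iteratedFDeriv ℝ 2 f x ![v, v] := by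
  have hline (s : ℝ) : HasDerivAt (fun s : ℝ => x + s • v) v s := by
    simpa using ((hasDerivAt_id s).smul_const v).const_add x
  have h1 : deriv (fun s : ℝ => f (x + s • v)) = fun s => fderiv ℝ f (x + s • v) v :=
    funext fun s => ((hf _).hasFDerivAt.comp_hasDerivAt s (hline s)).deriv
  have h2 : HasDerivAt (fun s : ℝ => fderiv ℝ f (x + s • v)) (fderiv ℝ (fderiv ℝ f) x v) 0 := by
    refine HasFDerivAt.comp_hasDerivAt (0 : ℝ) ?_ (hline 0)
    simpa using hf'.hasFDerivAt
  rw [iteratedDeriv_succ, iteratedDeriv_one, h1, iteratedFDeriv_two_apply]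
  simpa using (h2.clm_apply (hasDerivAt_const (0 : ℝ) v)).deriv

lemma exp_le_quadratic {u : ℝ} (h0 : 0 ≤ u) (h2 : u ≤ 2) :
    Real.exp u ≤ 1 + u + 3 / 2 * u ^ 2 := by
  have hb : |Real.exp (u / 2) - 1 - u / 2| ≤ (u / 2) ^ 2 :=
    Real.abs_exp_sub_one_sub_id_le (by rw [abs_of_nonneg] <;> linarith)
  have hb' : Real.exp (u / 2) ≤ 1 + u / 2 + (u / 2) ^ 2 := by linarith [(abs_le.1 hb).2]
  calc Real.exp u = Real.exp (u / 2) ^ 2 := by rw [← Real.exp_nat_mul]; push_cast; ring_nf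
    _ ≤ (1 + u / 2 + (u / 2) ^ 2) ^ 2 := by gcongr
    _ ≤ 1 + u + 3 / 2 * u ^ 2 := by
      nlinarith [mul_nonneg (sq_nonneg u) (sub_nonneg.2 h2),
        mul_nonneg (mul_nonneg (sq_nonneg u) (sub_nonneg.2 h2)) h0]

lemma one_add_sq_div_two_le_cosh (x : ℝ) : 1 + x ^ 2 / 2 ≤ Real.cosh x := by
  have hsinh : (x / 2) ^ 2 ≤ Real.sinh (x / 2) ^ 2 := by
    rw [sq_le_sq, Real.abs_sinh]
    exact Real.self_le_sinh_iff.2 (abs_nonneg _)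
  have hcosh := Real.cosh_two_mul (x / 2)
  rw [mul_div_cancel₀ x two_ne_zero, Real.cosh_sq] at hcosh
  linarith

/-- A bound on the exponential moments of `Y` yields a bound on its second moment. -/
lemma integral_sq_le_of_mgf_le {Ω : Type*} [MeasurableSpace Ω] {ν : Measure Ω}
    [IsProbabilityMeasure ν] {Y : Ω → ℝ} {ε w : ℝ}
    (hint : ∀ s, Integrable (fun ω => Real.exp (s * Y ω)) ν)
    (hmgf : ∀ s, mgf Y ν s ≤ Real.exp (s ^ 2 / 2 + ε))
    (hw : 0 < w) (hw1 : w ≤ 1) (hεw : ε ≤ w ^ 2) :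
    ∫ ω, Y ω ^ 2 ∂ν ≤ 1 + 7 * w := by
  have hsq : Integrable (fun ω => Y ω ^ 2) ν :=
    integrable_pow_of_integrable_exp_mul one_ne_zero (hint 1) (hint (-1)) 2
  set s := Real.sqrt (2 * w)
  have hs : s ^ 2 = 2 * w := Real.sq_sqrt (by positivity)
  have hpt (ω : Ω) : 2 + 2 * w * Y ω ^ 2 ≤ Real.exp (s * Y ω) + Real.exp (-s * Y ω) := by
    have h := one_add_sq_div_two_le_cosh (s * Y ω)
    rw [Real.cosh_eq, mul_pow, hs, ← neg_mul] at h
    linarith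
  have hmono : 2 + 2 * w * ∫ ω, Y ω ^ 2 ∂ν ≤ mgf Y ν s + mgf Y ν (-s) := by
    have h := integral_mono ((integrable_const (2 : ℝ)).add (hsq.const_mul (2 * w)))
      ((hint s).add (hint (-s))) hpt
    simp only [Pi.add_apply] at h
    rw [integral_add (integrable_const _) (hsq.const_mul _), integral_const_mul,
      integral_add (hint s) (hint (-s))] at h
    simpa [mgf] using h
  have hexp : Real.exp (s ^ 2 / 2 + ε) ≤ 1 + w + 7 * w ^ 2 := by
    calc Real.exp (s ^ 2 / 2 + ε) ≤ Real.exp (w + w ^ 2) :=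
          Real.exp_le_exp.2 (by linarith)
      _ ≤ 1 + (w + w ^ 2) + 3 / 2 * (w + w ^ 2) ^ 2 :=
          exp_le_quadratic (by positivity) (by nlinarith)
      _ ≤ 1 + w + 7 * w ^ 2 := by
          have h3 : w ^ 3 ≤ w ^ 2 := pow_le_pow_of_le_one hw.le hw1 (by norm_num)
          have h4 : w ^ 4 ≤ w ^ 2 := pow_le_pow_of_le_one hw.le hw1 (by norm_num)
          nlinarith
  have hneg := hmgf (-s)
  rw [neg_sq] at hneg
  refine le_of_mul_le_mul_left ?_ hw
  nlinarith [hmgf s]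

/-- Under the tilted measure at `h`, the function `Afun` along a line through `h` is expressed by
the cumulant generating function of the centred linear functional `⟪θ, · - h⟫`. -/
lemma Afun_line_eq {d : ℕ} {μ : Measure (EuclideanSpace ℝ (Fin d))} [IsProbabilityMeasure μ]
    (hμ : IsSubGaussian μ) (h θ : EuclideanSpace ℝ (Fin d)) (hθ : ‖θ‖ = 1) (s : ℝ) :
    Afun μ (h + s • θ) = Afun μ h + s ^ 2 / 2
      - cgf (fun x => ⟪θ, x - h⟫) (μ.tilted fun x => ⟪h, x⟫) s := by
  have hpos (t : EuclideanSpace ℝ (Fin d)) : 0 < ∫ x, Real.exp ⟪t, x⟫ ∂μ :=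
    integral_exp_pos (hμ.integrable_exp_inner_s12 t)
  have hmgf : mgf (fun x => ⟪θ, x - h⟫) (μ.tilted fun x => ⟪h, x⟫) s =
      Real.exp (-(s * ⟪θ, h⟫)) * ((∫ x, Real.exp ⟪h + s • θ, x⟫ ∂μ) /
        ∫ x, Real.exp ⟪h, x⟫ ∂μ) := by
    rw [mgf, integral_tilted, ← integral_div, ← integral_const_mul]
    refine integral_congr_ae (.of_forall fun x => ?_)
    simp only [smul_eq_mul, inner_sub_right, inner_add_left, real_inner_smul_left]
    rw [div_mul_eq_mul_div, ← mul_div_assoc, ← Real.exp_add, ← Real.exp_add]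
    ring_nf
  rw [cgf, hmgf, Real.log_mul (Real.exp_ne_zero _) (div_pos (hpos _) (hpos _)).ne', Real.log_exp,
    Real.log_div (hpos _).ne' (hpos _).ne', Afun, Afun, Kfun, Kfun, norm_add_sq_real,
    norm_smul, hθ, real_inner_smul_right, real_inner_comm, mul_one, Real.norm_eq_abs, sq_abs]
  ring

/-- The Hessian of `Afun` is bounded below in terms of any `w ∈ (0, 1]` with `Afun μ h ≤ w ^ 2`. -/
lemma neg_le_iteratedFDeriv_two_Afun {d : ℕ} {μ : Measure (EuclideanSpace ℝ (Fin d))}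
    [IsProbabilityMeasure μ] (hμ : IsSubGaussian μ) (hA : ∀ h, 0 ≤ Afun μ h)
    (h θ : EuclideanSpace ℝ (Fin d)) (hθ : ‖θ‖ = 1) {w : ℝ} (hw : 0 < w) (hw1 : w ≤ 1)
    (hAw : Afun μ h ≤ w ^ 2) :
    -(7 * w) ≤ iteratedFDeriv ℝ 2 (Afun μ) h ![θ, θ] := by
  by_cases hdiff : DifferentiableAt ℝ (fderiv ℝ (Afun μ)) h
  swap
  · rw [iteratedFDeriv_two_apply, fderiv_zero_of_not_differentiableAt hdiff]
    simpa using hw.le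
  rw [← iteratedDeriv_two_comp_line hμ.differentiable_Afun hdiff]
  set ν := μ.tilted fun x => ⟪h, x⟫
  set Y : EuclideanSpace ℝ (Fin d) → ℝ := fun x => ⟪θ, x - h⟫
  have : IsProbabilityMeasure ν := isProbabilityMeasure_tilted (hμ.integrable_exp_inner_s12 h)
  have hint (s : ℝ) : Integrable (fun x => Real.exp (s * Y x)) ν := by
    rw [integrable_tilted_iff (hμ.integrable_exp_inner_s12 h)]
    convert (hμ.integrable_exp_inner_s12 (h + s • θ)).const_mul (Real.exp (-(s * ⟪θ, h⟫))) using 2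
    simp only [Y, smul_eq_mul, inner_sub_right, inner_add_left, real_inner_smul_left]
    rw [← Real.exp_add, ← Real.exp_add]
    ring_nf
  have hset : integrableExpSet Y ν = Set.univ := Set.eq_univ_of_forall hint
  have hmem (s : ℝ) : s ∈ interior (integrableExpSet Y ν) := by simp [hset]
  have hline : (fun s : ℝ => Afun μ (h + s • θ)) =
      fun s => (Afun μ h + s ^ 2 / 2) - cgf Y ν s := funext (Afun_line_eq hμ h θ hθ)
  have hmgf (s : ℝ) : mgf Y ν s ≤ Real.exp (s ^ 2 / 2 + Afun μ h) := by
    rw [← exp_cgf (hint s)]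
    refine Real.exp_le_exp.2 ?_
    have h1 := hA (h + s • θ)
    rw [Afun_line_eq hμ h θ hθ s] at h1
    linarith
  have hcgf : iteratedDeriv 2 (cgf Y ν) 0 ≤ ∫ x, Y x ^ 2 ∂ν := by
    rw [iteratedDeriv_two_cgf (hmem 0)]
    simp only [zero_mul, Real.exp_zero, mul_one, mgf_zero, div_one]
    exact sub_le_self _ (sq_nonneg _)
  have hquad : iteratedDeriv 2 (fun s : ℝ => Afun μ h + s ^ 2 / 2) 0 = 1 := by
    rw [iteratedDeriv_succ, iteratedDeriv_one]
    have : deriv (fun s : ℝ => Afun μ h + s ^ 2 / 2) = fun s => s := by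
      ext s
      simp
    simp [this]
  rw [hline, iteratedDeriv_fun_sub (by fun_prop) (analyticAt_cgf (hmem 0)).contDiffAt, hquad]
  have := integral_sq_le_of_mgf_le hint hmgf hw hw1 hAw
  linarith

theorem stmt12 (d : ℕ) (hd : 1 ≤ d) :
    ∃ C : ℝ, 0 < C ∧
      ∀ (μ : Measure (EuclideanSpace ℝ (Fin d))),
        IsProbabilityMeasure μ → IsSubGaussian μ → (∀ h, 0 ≤ Afun μ h) →
        ∀ h : EuclideanSpace ℝ (Fin d), Afun μ h ≤ 1 →
          ∀ θ : EuclideanSpace ℝ (Fin d), ‖θ‖ = 1 →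
            -(C * Afun μ h ^ ((1 : ℝ) / 4)) ≤ iteratedFDeriv ℝ 2 (Afun μ) h ![θ, θ] := by
  refine ⟨7, by norm_num, fun μ _ hμ hA h hA1 θ hθ => ?_⟩
  rcases (hA h).eq_or_lt with h0 | h0
  · rw [← h0, Real.zero_rpow (by norm_num), mul_zero, neg_zero]
    by_contra! hneg
    set q := iteratedFDeriv ℝ 2 (Afun μ) h ![θ, θ]
    have hw : 0 < min 1 (-q / 14) := lt_min one_pos (by linarith)
    have key := neg_le_iteratedFDeriv_two_Afun hμ hA h θ hθ hw (min_le_left _ _)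
      (by rw [← h0]; positivity)
    linarith [min_le_right 1 (-q / 14)]
  · refine neg_le_iteratedFDeriv_two_Afun hμ hA h θ hθ (Real.rpow_pos_of_pos h0 _)
      (Real.rpow_le_one h0.le hA1 (by norm_num)) ?_
    rw [← Real.rpow_natCast, ← Real.rpow_mul h0.le]
    exact Real.self_le_rpow_of_le_one h0.le hA1 (by norm_num)
end

section
/- Let X be a sub-Gaussian random vector in ℝ^d with density p satisfying p(x) ≤ c φ(x) for almost every x ∈ ℝ^d (c ≥ 1 a constant). Then for every h ∈ ℝ^d: det(K''(h))^{1/2} ≥ (1/c) e^{−A(h) − d/2}, where K''(h) is the Hessian of K(t) = log E exp(⟨t,X⟩) and A(h) = |h|²/2 − K(h). -/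
open MeasureTheory ProbabilityTheory Real Filter
open scoped ENNReal RealInnerProductSpace Topology

/-- The standard normal density `φ` on `ℝ^d`. -/
noncomputable def gaussPDF (d : ℕ) (x : EuclideanSpace ℝ (Fin d)) : ℝ :=
  (2 * Real.pi) ^ (-(d : ℝ) / 2) * Real.exp (-‖x‖ ^ 2 / 2)

/-- The Hessian matrix of a function on Euclidean space, in the standard basis. -/
noncomputable def hessMatrix {d : ℕ} (f : EuclideanSpace ℝ (Fin d) → ℝ)
    (t : EuclideanSpace ℝ (Fin d)) : Matrix (Fin d) (Fin d) ℝ :=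
  Matrix.of fun i j =>
    iteratedFDeriv ℝ 2 f t ![EuclideanSpace.single i 1, EuclideanSpace.single j 1]

theorem integral_comp_linearMap_sub {E F : Type*} [NormedAddCommGroup E] [NormedSpace ℝ E]
    [MeasurableSpace E] [BorelSpace E] [FiniteDimensional ℝ E] [NormedAddCommGroup F]
    [NormedSpace ℝ F] (μ : Measure E) [μ.IsAddHaarMeasure] {T : E →ₗ[ℝ] E}
    (hT : LinearMap.det T ≠ 0) (f : E → F) (m : E) :
    ∫ x, f (T (x - m)) ∂μ = |(LinearMap.det T)⁻¹| • ∫ x, f x ∂μ := by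
  have hT' : MeasurableEmbedding T :=
    (T.equivOfDetNeZero hT).toContinuousLinearEquiv.toHomeomorph.measurableEmbedding
  rw [integral_sub_right_eq_self (fun x => f (T x)) m, ← hT'.integral_map,
    Measure.map_linearMap_addHaar_eq_smul_addHaar μ hT, integral_smul_measure,
    ENNReal.toReal_ofReal (abs_nonneg _)]

theorem integral_exp_neg_half_norm_sq_comp {d : ℕ} {B : Matrix (Fin d) (Fin d) ℝ}
    (hB : B.det ≠ 0) (m : EuclideanSpace ℝ (Fin d)) :
    ∫ x, Real.exp (-(1 / 2) * ‖Matrix.toEuclideanLin B (x - m)‖ ^ 2)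
      = |B.det|⁻¹ * (2 * π) ^ ((d : ℝ) / 2) := by
  have hdet : LinearMap.det (Matrix.toEuclideanLin B) = B.det := by
    rw [Matrix.toEuclideanLin_eq_toLin_orthonormal, LinearMap.det_toLin]
  rw [integral_comp_linearMap_sub volume (by rwa [hdet])
    (fun y => Real.exp (-(1 / 2) * ‖y‖ ^ 2)) m,
    GaussianFourier.integral_rexp_neg_mul_sq_norm (by norm_num), hdet, abs_inv]
  simp [mul_comm]

section Moments

variable {d : ℕ} {q : EuclideanSpace ℝ (Fin d) → ℝ}

theorem integrable_coord_sub_mul (hq0 : ∀ x, 0 ≤ q x) (hqi : Integrable q)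
    (hq2 : Integrable fun x => ‖x‖ ^ 2 * q x) (m : EuclideanSpace ℝ (Fin d)) (i j : Fin d) :
    Integrable fun x => (x i - m i) * (x j - m j) * q x := by
  refine ((hq2.const_mul 2).add (hqi.const_mul (2 * ‖m‖ ^ 2))).mono'
    (AEStronglyMeasurable.mul (by fun_prop) hqi.1) (Eventually.of_forall fun x => ?_)
  have h1 : ∀ k, |x k - m k| ≤ ‖x‖ + ‖m‖ := fun k =>
    (PiLp.norm_apply_le (x - m) k).trans (norm_sub_le x m)
  have h2 : |x i - m i| * |x j - m j| ≤ (‖x‖ + ‖m‖) * (‖x‖ + ‖m‖) :=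
    mul_le_mul (h1 i) (h1 j) (abs_nonneg _) (by positivity)
  rw [norm_eq_abs, abs_mul, abs_mul, abs_of_nonneg (hq0 x)]
  have := mul_le_mul_of_nonneg_right h2 (hq0 x)
  have := mul_nonneg (sq_nonneg (‖x‖ - ‖m‖)) (hq0 x)
  simp only [Pi.add_apply]
  nlinarith

theorem integrable_coord_mul (hq0 : ∀ x, 0 ≤ q x) (hqi : Integrable q)
    (hq2 : Integrable fun x => ‖x‖ ^ 2 * q x) (i : Fin d) : Integrable fun x => x i * q x := by
  refine (hq2.add hqi).mono' (AEStronglyMeasurable.mul (by fun_prop) hqi.1)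
    (Eventually.of_forall fun x => ?_)
  have h1 : |x i| ≤ ‖x‖ := PiLp.norm_apply_le x i
  have h2 : |x i| ≤ ‖x‖ ^ 2 + 1 := by nlinarith [sq_nonneg (‖x‖ - 1 / 2)]
  rw [norm_eq_abs, abs_mul, abs_of_nonneg (hq0 x)]
  simpa [add_mul] using mul_le_mul_of_nonneg_right h2 (hq0 x)

theorem integral_coord_sub_mean_mul (hq0 : ∀ x, 0 ≤ q x) (hq1 : ∫ x, q x = 1)
    (hq2 : Integrable fun x => ‖x‖ ^ 2 * q x) {m : EuclideanSpace ℝ (Fin d)}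
    (hm : ∀ i, m i = ∫ x, x i * q x) (i j : Fin d) :
    ∫ x, (x i - m i) * (x j - m j) * q x = (∫ x, x i * x j * q x) - m i * m j := by
  have hqi : Integrable q := .of_integral_ne_zero (by simp [hq1])
  have h₁ := integrable_coord_mul hq0 hqi hq2
  have h₂ : Integrable fun x : EuclideanSpace ℝ (Fin d) => x i * x j * q x := by
    simpa using integrable_coord_sub_mul hq0 hqi hq2 0 i j
  have h₃ : Integrable fun x : EuclideanSpace ℝ (Fin d) =>
      x i * x j * q x - m j * (x i * q x) := h₂.sub ((h₁ i).const_mul _)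
  have h₄ : Integrable fun x : EuclideanSpace ℝ (Fin d) =>
      x i * x j * q x - m j * (x i * q x) - m i * (x j * q x) := h₃.sub ((h₁ j).const_mul _)
  calc ∫ x, (x i - m i) * (x j - m j) * q x
      = ∫ x, (x i * x j * q x - m j * (x i * q x) - m i * (x j * q x) + m i * m j * q x) :=
        integral_congr_ae (Eventually.of_forall fun x => by ring)
    _ = (∫ x, x i * x j * q x) - m j * m i - m i * m j + m i * m j * 1 := by
        rw [integral_add h₄ (hqi.const_mul _), integral_sub h₃ ((h₁ j).const_mul _),
          integral_sub h₂ ((h₁ i).const_mul _), integral_const_mul, integral_const_mul,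
          integral_const_mul, hq1, ← hm, ← hm]
    _ = _ := by ring

theorem integrable_sum_mul_coord_sub (hq0 : ∀ x, 0 ≤ q x) (hqi : Integrable q)
    (hq2 : Integrable fun x => ‖x‖ ^ 2 * q x) (m : EuclideanSpace ℝ (Fin d))
    (N : Matrix (Fin d) (Fin d) ℝ) :
    Integrable fun x => (∑ i, ∑ j, N i j * ((x i - m i) * (x j - m j))) * q x := by
  simp_rw [Finset.sum_mul]
  refine integrable_finsetSum _ fun i _ => integrable_finsetSum _ fun j _ => ?_
  simpa only [mul_assoc] using (integrable_coord_sub_mul hq0 hqi hq2 m i j).const_mul (N i j)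

theorem integral_sum_mul_coord_sub (hq0 : ∀ x, 0 ≤ q x) (hqi : Integrable q)
    (hq2 : Integrable fun x => ‖x‖ ^ 2 * q x) (m : EuclideanSpace ℝ (Fin d))
    (N : Matrix (Fin d) (Fin d) ℝ) :
    ∫ x, (∑ i, ∑ j, N i j * ((x i - m i) * (x j - m j))) * q x
      = ∑ i, ∑ j, N i j * ∫ x, (x i - m i) * (x j - m j) * q x := by
  have hquad : ∀ i j, Integrable fun x => N i j * ((x i - m i) * (x j - m j) * q x) :=
    fun i j => (integrable_coord_sub_mul hq0 hqi hq2 m i j).const_mul (N i j)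
  simp_rw [Finset.sum_mul, mul_assoc (N _ _)]
  rw [integral_finsetSum _ fun i _ => integrable_finsetSum _ fun j _ => hquad i j]
  refine Finset.sum_congr rfl fun i _ => ?_
  rw [integral_finsetSum _ fun j _ => hquad i j]
  exact Finset.sum_congr rfl fun j _ => integral_const_mul _ _

/-- The matrix of second moments of a density about a point is positive definite. -/
theorem posDef_secondMoment (hq0 : ∀ x, 0 ≤ q x) (hq1 : ∫ x, q x = 1)
    (hq2 : Integrable fun x => ‖x‖ ^ 2 * q x) (m : EuclideanSpace ℝ (Fin d))
    {S : Matrix (Fin d) (Fin d) ℝ}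
    (hS : ∀ i j, S i j = ∫ x, (x i - m i) * (x j - m j) * q x) : S.PosDef := by
  have hqi : Integrable q := .of_integral_ne_zero (by simp [hq1])
  refine .of_dotProduct_mulVec_pos ?_ fun v hv => ?_
  · ext i j
    simp only [Matrix.conjTranspose_apply, star_trivial, hS]
    exact integral_congr_ae (Eventually.of_forall fun x => by ring)
  have hsq : ∀ x : EuclideanSpace ℝ (Fin d),
      ∑ i, ∑ j, Matrix.vecMulVec v v i j * ((x i - m i) * (x j - m j))
        = (∑ i, v i * (x i - m i)) ^ 2 := fun x => by
    rw [sq, Finset.sum_mul_sum]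
    refine Finset.sum_congr rfl fun i _ => Finset.sum_congr rfl fun j _ => ?_
    rw [Matrix.vecMulVec_apply]; ring
  have hquad := integrable_sum_mul_coord_sub hq0 hqi hq2 m (Matrix.vecMulVec v v)
  have heq := integral_sum_mul_coord_sub hq0 hqi hq2 m (Matrix.vecMulVec v v)
  simp_rw [hsq, ← hS] at hquad heq
  have hval : star v ⬝ᵥ S.mulVec v = ∫ x, (∑ i, v i * (x i - m i)) ^ 2 * q x := by
    rw [heq]
    simp only [dotProduct, Matrix.mulVec, star_trivial, Finset.mul_sum, Matrix.vecMulVec_apply]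
    refine Finset.sum_congr rfl fun i _ => Finset.sum_congr rfl fun j _ => by ring
  have hnn : ∀ x : EuclideanSpace ℝ (Fin d), 0 ≤ (∑ i, v i * (x i - m i)) ^ 2 * q x :=
    fun x => mul_nonneg (sq_nonneg _) (hq0 x)
  rw [hval]
  refine (integral_nonneg hnn).lt_of_ne fun h0 => ?_
  rw [eq_comm, integral_eq_zero_iff_of_nonneg hnn hquad] at h0
  set V : EuclideanSpace ℝ (Fin d) := WithLp.toLp 2 v
  have hV : V ≠ 0 := fun h => hv (by simpa [V] using h)
  have hker : LinearMap.ker (innerₛₗ ℝ V) ≠ ⊤ := fun h =>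
    hV (inner_self_eq_zero.1 (LinearMap.mem_ker.1
      (h ▸ Submodule.mem_top : V ∈ LinearMap.ker (innerₛₗ ℝ V))))
  have hnull := Measure.addHaar_submodule volume (LinearMap.ker (innerₛₗ ℝ V)) hker
  have hnull' : ∀ᵐ x : EuclideanSpace ℝ (Fin d), ⟪V, x - m⟫ ≠ 0 := by
    have := (measurePreserving_sub_right volume m).quasiMeasurePreserving.ae
      (p := fun x : EuclideanSpace ℝ (Fin d) => ⟪V, x⟫ ≠ 0) (by
        rw [ae_iff]
        convert hnull using 2
        ext x
        simp)
    exact this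
  have : ∫ x, q x = 0 := by
    refine integral_eq_zero_of_ae ?_
    filter_upwards [h0, hnull'] with x hx hx'
    refine (mul_eq_zero.1 hx).resolve_left (pow_ne_zero 2 ?_)
    simpa [PiLp.inner_apply, V, mul_comm] using hx'
  simp [hq1] at this

open scoped MatrixOrder in
/-- A density bounded by `M` has second-moment determinant bounded below in terms of `M`:
this is the maximum entropy property of the Gaussian. -/
theorem one_le_mul_sqrt_det_secondMoment (hq0 : ∀ x, 0 ≤ q x) (hq1 : ∫ x, q x = 1)
    (hq2 : Integrable fun x => ‖x‖ ^ 2 * q x) {M : ℝ} (hM : ∀ᵐ x, q x ≤ M)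
    (m : EuclideanSpace ℝ (Fin d)) {S : Matrix (Fin d) (Fin d) ℝ}
    (hS : ∀ i j, S i j = ∫ x, (x i - m i) * (x j - m j) * q x) :
    1 ≤ M * Real.exp ((d : ℝ) / 2) * (2 * π) ^ ((d : ℝ) / 2) * √S.det := by
  have hqi : Integrable q := .of_integral_ne_zero (by simp [hq1])
  have hpos := posDef_secondMoment hq0 hq1 hq2 m hS
  obtain ⟨B, hB⟩ := CStarAlgebra.nonneg_iff_eq_star_mul_self.1 hpos.inv.posSemidef.nonneg
  rw [Matrix.star_eq_conjTranspose, Matrix.conjTranspose_eq_transpose_of_trivial] at hB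
  have hdet : S.det⁻¹ = B.det ^ 2 := by
    rw [← Ring.inverse_eq_inv', ← Matrix.det_nonsing_inv, hB, Matrix.det_mul,
      Matrix.det_transpose, sq]
  have hBdet : B.det ≠ 0 := fun h => by simp [h, hpos.det_pos.ne'] at hdet
  have hsqrt : |B.det|⁻¹ = √S.det := by
    rw [← inv_inv S.det, hdet, Real.sqrt_inv, Real.sqrt_sq_eq_abs]
  have hnorm : ∀ x : EuclideanSpace ℝ (Fin d), ‖Matrix.toEuclideanLin B (x - m)‖ ^ 2
      = ∑ i, ∑ j, S⁻¹ i j * ((x i - m i) * (x j - m j)) := fun x => by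
    have : ‖Matrix.toEuclideanLin B (x - m)‖ ^ 2
        = (x - m).ofLp ⬝ᵥ (S⁻¹).mulVec (x - m).ofLp := by
      rw [EuclideanSpace.real_norm_sq_eq, hB, ← Matrix.mulVec_mulVec,
        Matrix.dotProduct_mulVec, Matrix.vecMul_transpose]
      simp [dotProduct, sq, Matrix.toLpLin_apply]
    rw [this]
    simp only [dotProduct, Matrix.mulVec, Finset.mul_sum, PiLp.sub_apply]
    refine Finset.sum_congr rfl fun i _ => Finset.sum_congr rfl fun j _ => by ring
  have hquad := integrable_sum_mul_coord_sub hq0 hqi hq2 m S⁻¹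
  have heq := integral_sum_mul_coord_sub hq0 hqi hq2 m S⁻¹
  simp_rw [← hnorm, ← hS] at hquad heq
  have htrace : ∑ i, ∑ j, S⁻¹ i j * S i j = d := by
    have hsymm : ∀ i j, S i j = S j i := fun i j => by simpa using (hpos.isHermitian.apply i j).symm
    calc ∑ i, ∑ j, S⁻¹ i j * S i j = (S⁻¹ * S).trace := by
          simp only [Matrix.trace, Matrix.diag, Matrix.mul_apply]
          exact Finset.sum_congr rfl fun i _ => Finset.sum_congr rfl fun j _ => by rw [hsymm i j]
      _ = d := by rw [Matrix.nonsing_inv_mul _ hpos.det_pos.ne'.isUnit]; simp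
  rw [htrace] at heq
  have hgauss := integral_exp_neg_half_norm_sq_comp hBdet m
  have hgint : Integrable fun x => Real.exp (-(1 / 2) * ‖Matrix.toEuclideanLin B (x - m)‖ ^ 2) :=
    .of_integral_ne_zero (by rw [hgauss]; positivity)
  calc (1 : ℝ) = ∫ x, ((1 + (d : ℝ) / 2) * q x
        - 1 / 2 * (‖Matrix.toEuclideanLin B (x - m)‖ ^ 2 * q x)) := by
        rw [integral_sub (hqi.const_mul _) (hquad.const_mul _), integral_const_mul,
          integral_const_mul, hq1, heq]
        ring
    _ ≤ ∫ x, M * Real.exp ((d : ℝ) / 2)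
        * Real.exp (-(1 / 2) * ‖Matrix.toEuclideanLin B (x - m)‖ ^ 2) := by
        refine integral_mono_ae ((hqi.const_mul _).sub (hquad.const_mul _)) (hgint.const_mul _) ?_
        filter_upwards [hM] with x hx
        have h1 := mul_le_mul_of_nonneg_right (Real.add_one_le_exp
          ((d : ℝ) / 2 + -(1 / 2) * ‖Matrix.toEuclideanLin B (x - m)‖ ^ 2)) (hq0 x)
        have h2 := mul_le_mul_of_nonneg_left hx (Real.exp_pos
          ((d : ℝ) / 2 + -(1 / 2) * ‖Matrix.toEuclideanLin B (x - m)‖ ^ 2)).le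
        rw [mul_assoc, ← Real.exp_add]
        linarith
    _ = _ := by rw [integral_const_mul, hgauss, hsqrt]; ring

end Moments

theorem mul_le_mul_sq_add_sq_div {a : ℝ} (ha : 0 < a) (r s : ℝ) :
    r * s ≤ a * s ^ 2 + r ^ 2 / (4 * a) := by
  have h : a * s ^ 2 + r ^ 2 / (4 * a) - r * s = (2 * a * s - r) ^ 2 / (4 * a) := by
    field_simp; ring
  have : 0 ≤ (2 * a * s - r) ^ 2 / (4 * a) := by positivity
  linarith

theorem integrable_exp_mul_norm {E F : Type*} [NormedAddCommGroup E] [MeasurableSpace E]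
    [BorelSpace E] [SecondCountableTopology E] [NormedAddCommGroup F] {μ : Measure E} {w : E → F}
    {a : ℝ} (ha : 0 < a) (hw : AEStronglyMeasurable w μ)
    (hi : Integrable (fun x => Real.exp (a * ‖x‖ ^ 2) * ‖w x‖) μ) (r : ℝ) :
    Integrable (fun x => Real.exp (r * ‖x‖) * ‖w x‖) μ := by
  refine (hi.const_mul (Real.exp (r ^ 2 / (4 * a)))).mono'
    (AEStronglyMeasurable.mul (by fun_prop) hw.norm) (Eventually.of_forall fun x => ?_)
  rw [Real.norm_of_nonneg (by positivity), ← mul_assoc, ← Real.exp_add]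
  gcongr
  linarith [mul_le_mul_sq_add_sq_div ha r ‖x‖]

section Laplace

variable {E F : Type*} [NormedAddCommGroup E] [InnerProductSpace ℝ E] [MeasurableSpace E]
  [BorelSpace E] [SecondCountableTopology E] [NormedAddCommGroup F] [NormedSpace ℝ F]
  {μ : Measure E} {w : E → F} {a : ℝ}

theorem integrable_exp_inner_smul (ha : 0 < a) (hw : AEStronglyMeasurable w μ)
    (hi : Integrable (fun x => Real.exp (a * ‖x‖ ^ 2) * ‖w x‖) μ) (t : E) :
    Integrable (fun x => Real.exp ⟪t, x⟫ • w x) μ := by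
  refine (integrable_exp_mul_norm ha hw hi ‖t‖).mono'
    (AEStronglyMeasurable.smul (by fun_prop) hw) (Eventually.of_forall fun x => ?_)
  rw [norm_smul, Real.norm_of_nonneg (Real.exp_pos _).le]
  gcongr
  exact real_inner_le_norm t x

theorem aestronglyMeasurable_innerSL_smulRight (hw : AEStronglyMeasurable w μ) :
    AEStronglyMeasurable (fun x => (innerSL ℝ x).smulRight (w x)) μ := by
  have : Continuous fun z : E × F => (innerSL ℝ z.1).smulRight z.2 := by fun_prop
  exact this.comp_aestronglyMeasurable (AEStronglyMeasurable.prodMk (by fun_prop) hw)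

theorem integrable_exp_mul_norm_smulRight (ha : 0 < a) (hw : AEStronglyMeasurable w μ)
    (hi : Integrable (fun x => Real.exp (a * ‖x‖ ^ 2) * ‖w x‖) μ) :
    Integrable (fun x => Real.exp (a / 2 * ‖x‖ ^ 2) * ‖(innerSL ℝ x).smulRight (w x)‖) μ := by
  refine (hi.const_mul (Real.exp (1 ^ 2 / (4 * (a / 2))))).mono'
    (AEStronglyMeasurable.mul (by fun_prop) (aestronglyMeasurable_innerSL_smulRight hw).norm)
    (Eventually.of_forall fun x => ?_)
  rw [Real.norm_of_nonneg (by positivity), ContinuousLinearMap.norm_smulRight_apply,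
    innerSL_apply_norm, ← mul_assoc, ← mul_assoc, ← Real.exp_add]
  gcongr
  calc Real.exp (a / 2 * ‖x‖ ^ 2) * ‖x‖
      ≤ Real.exp (a / 2 * ‖x‖ ^ 2) * Real.exp ‖x‖ := by
        gcongr; linarith [Real.add_one_le_exp ‖x‖]
    _ ≤ _ := by
        rw [← Real.exp_add, Real.exp_le_exp]
        linarith [mul_le_mul_sq_add_sq_div (half_pos ha) 1 ‖x‖]

/-- Differentiation under the integral sign of a (vector-valued) Laplace transform. -/
theorem hasFDerivAt_integral_exp_inner_smul (ha : 0 < a) (hw : AEStronglyMeasurable w μ)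
    (hi : Integrable (fun x => Real.exp (a * ‖x‖ ^ 2) * ‖w x‖) μ) (t : E) :
    HasFDerivAt (fun t => ∫ x, Real.exp ⟪t, x⟫ • w x ∂μ)
      (∫ x, Real.exp ⟪t, x⟫ • (innerSL ℝ x).smulRight (w x) ∂μ) t := by
  have hw' := aestronglyMeasurable_innerSL_smulRight hw
  have hi' := integrable_exp_mul_norm_smulRight ha hw hi
  refine hasFDerivAt_integral_of_dominated_of_fderiv_le (Metric.ball_mem_nhds t one_pos)
    (F' := fun t x => Real.exp ⟪t, x⟫ • (innerSL ℝ x).smulRight (w x))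
    (Eventually.of_forall fun s => (integrable_exp_inner_smul ha hw hi s).1)
    (integrable_exp_inner_smul ha hw hi t)
    (integrable_exp_inner_smul (half_pos ha) hw' hi' t).1
    (Eventually.of_forall fun x s hs => ?_)
    (integrable_exp_mul_norm (half_pos ha) hw' hi' (‖t‖ + 1))
    (Eventually.of_forall fun x s _ => ?_)
  · rw [norm_smul, Real.norm_of_nonneg (Real.exp_pos _).le]
    gcongr
    refine (real_inner_le_norm s x).trans ?_
    gcongr
    have : ‖s‖ ≤ ‖t‖ + ‖s - t‖ := by simpa using norm_add_le t (s - t)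
    have := mem_ball_iff_norm.1 hs
    linarith
  · have h1 : HasFDerivAt (fun s : E => ⟪s, x⟫) (innerSL ℝ x) s := by
      have heq : (fun s : E => ⟪s, x⟫) = innerSL ℝ x := funext fun s => real_inner_comm x s
      rw [heq]
      exact (innerSL ℝ x).hasFDerivAt
    convert h1.exp.smul_const (w x) using 1
    ext y
    simp [smul_smul]

end Laplace

theorem integral_exp_mul_pos {α : Type*} [MeasurableSpace α] {μ : Measure α} {f p : α → ℝ}
    (hp0 : ∀ x, 0 ≤ p x) (hp : 0 < ∫ x, p x ∂μ)
    (hi : Integrable (fun x => Real.exp (f x) * p x) μ) :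
    0 < ∫ x, Real.exp (f x) * p x ∂μ := by
  have hpi : Integrable p μ := .of_integral_ne_zero hp.ne'
  rw [integral_pos_iff_support_of_nonneg hp0 hpi] at hp
  rw [integral_pos_iff_support_of_nonneg
    (fun x => mul_nonneg (Real.exp_pos _).le (hp0 x)) hi]
  convert hp using 2
  ext x
  simp [Real.exp_ne_zero]

section CumulantHessian

variable {E : Type*} [NormedAddCommGroup E] [InnerProductSpace ℝ E] [MeasurableSpace E]
  [BorelSpace E] [SecondCountableTopology E] {μ : Measure E} {p : E → ℝ} {a : ℝ}

/-- The second derivative of a cumulant generating function, in terms of the second and first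
moments of the exponentially tilted density. -/
theorem iteratedFDeriv_two_log_integral_exp_inner (ha : 0 < a)
    (hpm : AEStronglyMeasurable p μ) (hp0 : ∀ x, 0 ≤ p x) (hp : 0 < ∫ x, p x ∂μ)
    (hi : Integrable (fun x => Real.exp (a * ‖x‖ ^ 2) * p x) μ) (t u v : E) :
    iteratedFDeriv ℝ 2 (fun t => Real.log (∫ x, Real.exp ⟪t, x⟫ * p x ∂μ)) t ![u, v]
      = (∫ x, Real.exp ⟪t, x⟫ * p x ∂μ)⁻¹ * (∫ x, ⟪x, u⟫ * ⟪x, v⟫ * (Real.exp ⟪t, x⟫ * p x) ∂μ)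
        - ((∫ x, Real.exp ⟪t, x⟫ * p x ∂μ)⁻¹ * ∫ x, ⟪x, u⟫ * (Real.exp ⟪t, x⟫ * p x) ∂μ)
          * ((∫ x, Real.exp ⟪t, x⟫ * p x ∂μ)⁻¹ * ∫ x, ⟪x, v⟫ * (Real.exp ⟪t, x⟫ * p x) ∂μ) := by
  have hi₀ : Integrable (fun x => Real.exp (a * ‖x‖ ^ 2) * ‖p x‖) μ := by
    simpa only [Real.norm_of_nonneg (hp0 _)] using hi
  have hm₁ := aestronglyMeasurable_innerSL_smulRight hpm
  have hi₁ := integrable_exp_mul_norm_smulRight ha hpm hi₀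
  have hm₂ := aestronglyMeasurable_innerSL_smulRight hm₁
  have hi₂ := integrable_exp_mul_norm_smulRight (half_pos ha) hm₁ hi₁
  have hquad₁ := integrable_exp_inner_smul (half_pos ha) hm₁ hi₁
  have hquad₂ := integrable_exp_inner_smul (half_pos (half_pos ha)) hm₂ hi₂ t
  have hL := hasFDerivAt_integral_exp_inner_smul ha hpm hi₀
  have hL₁ := hasFDerivAt_integral_exp_inner_smul (half_pos ha) hm₁ hi₁ t
  have hLpos : ∀ s : E, 0 < ∫ x, Real.exp ⟪s, x⟫ • p x ∂μ := fun s =>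
    integral_exp_mul_pos hp0 hp (integrable_exp_inner_smul ha hpm hi₀ s)
  simp_rw [← smul_eq_mul (Real.exp _)]
  have hfd : fderiv ℝ (fun t => Real.log (∫ x, Real.exp ⟪t, x⟫ • p x ∂μ)) = fun s =>
      (∫ x, Real.exp ⟪s, x⟫ • p x ∂μ)⁻¹
        • ∫ x, Real.exp ⟪s, x⟫ • (innerSL ℝ x).smulRight (p x) ∂μ :=
    funext fun s => ((hL s).log (hLpos s).ne').fderiv
  have happ₁ : ∀ y, (∫ x, Real.exp ⟪t, x⟫ • (innerSL ℝ x).smulRight (p x) ∂μ) y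
      = ∫ x, ⟪x, y⟫ * (Real.exp ⟪t, x⟫ • p x) ∂μ := fun y => by
    rw [ContinuousLinearMap.integral_apply (hquad₁ t)]
    refine integral_congr_ae (Eventually.of_forall fun x => ?_)
    simp; ring
  have happ₂ : (∫ x, Real.exp ⟪t, x⟫ • (innerSL ℝ x).smulRight ((innerSL ℝ x).smulRight (p x)) ∂μ)
      u v = ∫ x, ⟪x, u⟫ * ⟪x, v⟫ * (Real.exp ⟪t, x⟫ • p x) ∂μ := by
    rw [ContinuousLinearMap.integral_apply hquad₂,
      ContinuousLinearMap.integral_apply (hquad₂.apply_continuousLinearMap u)]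
    refine integral_congr_ae (Eventually.of_forall fun x => ?_)
    simp; ring
  have hinv : HasFDerivAt (fun s => (∫ x, Real.exp ⟪s, x⟫ • p x ∂μ)⁻¹) _ t :=
    (hasDerivAt_inv (hLpos t).ne').comp_hasFDerivAt t (hL t)
  rw [iteratedFDeriv_two_apply, hfd, (hinv.fun_smul hL₁).fderiv]
  simp [happ₁, happ₂]
  ring

end CumulantHessian

theorem stmt15 {d : ℕ} (hd : 1 ≤ d)
    (p : EuclideanSpace ℝ (Fin d) → ℝ)
    (hpm : Measurable p) (hp0 : ∀ x, 0 ≤ p x)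
    (hp1 : ∫ x, p x = 1)
    (hsubG : ∃ c > 0, Integrable (fun x => Real.exp (c * ‖x‖ ^ 2) * p x))
    (c : ℝ) (hc : 1 ≤ c)
    (hbound : ∀ᵐ x ∂(volume : Measure (EuclideanSpace ℝ (Fin d))),
      p x ≤ c * gaussPDF d x)
    (K A : EuclideanSpace ℝ (Fin d) → ℝ)
    (hK : ∀ t, K t = Real.log (∫ x, Real.exp ⟪t, x⟫ * p x))
    (hA : ∀ t, A t = ‖t‖ ^ 2 / 2 - K t)
    (h : EuclideanSpace ℝ (Fin d)) :
    (1 / c) * Real.exp (-A h - (d : ℝ) / 2) ≤ Real.sqrt (hessMatrix K h).det := by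
  obtain ⟨a, ha, hi⟩ := hsubG
  have hp : 0 < ∫ x, p x := by simp [hp1]
  have hi₀ : Integrable (fun x => Real.exp (a * ‖x‖ ^ 2) * ‖p x‖) := by
    simpa only [Real.norm_of_nonneg (hp0 _)] using hi
  have hw := hpm.aestronglyMeasurable (μ := volume)
  have hm₁ := aestronglyMeasurable_innerSL_smulRight hw
  have hi₁ := integrable_exp_mul_norm_smulRight ha hw hi₀
  have hm₂ := aestronglyMeasurable_innerSL_smulRight hm₁
  have hi₂ := integrable_exp_mul_norm_smulRight (half_pos ha) hm₁ hi₁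
  have hLint : Integrable fun x => Real.exp ⟪h, x⟫ * p x := integrable_exp_inner_smul ha hw hi₀ h
  have hLpos := integral_exp_mul_pos hp0 hp hLint
  have hHess := iteratedFDeriv_two_log_integral_exp_inner ha hw hp0 hp hi h
  have hKh := hK h
  obtain rfl : K = _ := funext hK
  set L := ∫ x, Real.exp ⟪h, x⟫ * p x with hL
  set q : EuclideanSpace ℝ (Fin d) → ℝ := fun x => L⁻¹ * (Real.exp ⟪h, x⟫ * p x) with hq
  have hq0 : ∀ x, 0 ≤ q x := fun x =>
    mul_nonneg (inv_nonneg.2 hLpos.le) (mul_nonneg (Real.exp_pos _).le (hp0 x))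
  have hqi : Integrable q := hLint.const_mul _
  have hq1 : ∫ x, q x = 1 := by
    rw [integral_const_mul, ← hL, inv_mul_cancel₀ hLpos.ne']
  have hq2 : Integrable fun x => ‖x‖ ^ 2 * q x := by
    refine ((integrable_exp_inner_smul (half_pos (half_pos ha)) hm₂ hi₂ h).norm.const_mul L⁻¹).congr
      (Eventually.of_forall fun x => ?_)
    simp only [hq, norm_smul, ContinuousLinearMap.norm_smulRight_apply, innerSL_apply_norm,
      Real.norm_of_nonneg (Real.exp_pos _).le, Real.norm_of_nonneg (hp0 x)]
    ring
  have hexpA : Real.exp (A h) = L⁻¹ * Real.exp (‖h‖ ^ 2 / 2) := by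
    rw [hA, hKh, Real.exp_sub, Real.exp_log hLpos]; ring
  have hqM : ∀ᵐ x, q x ≤ c * (2 * π) ^ (-(d : ℝ) / 2) * Real.exp (A h) := by
    filter_upwards [hbound] with x hx
    have hsq : Real.exp ⟪h, x⟫ * Real.exp (-‖x‖ ^ 2 / 2) ≤ Real.exp (‖h‖ ^ 2 / 2) := by
      rw [← Real.exp_add, Real.exp_le_exp]
      linarith [norm_sub_sq_real h x, sq_nonneg ‖h - x‖]
    calc q x ≤ L⁻¹ * (Real.exp ⟪h, x⟫ * (c * gaussPDF d x)) := by
          simp only [hq]; gcongr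
      _ = L⁻¹ * (c * (2 * π) ^ (-(d : ℝ) / 2) * (Real.exp ⟪h, x⟫ * Real.exp (-‖x‖ ^ 2 / 2))) := by
          rw [gaussPDF]; ring
      _ ≤ L⁻¹ * (c * (2 * π) ^ (-(d : ℝ) / 2) * Real.exp (‖h‖ ^ 2 / 2)) := by gcongr
      _ = _ := by rw [hexpA]; ring
  set m : EuclideanSpace ℝ (Fin d) := WithLp.toLp 2 fun i => ∫ x, x i * q x
  have hcov : ∀ i j, hessMatrix (fun t => Real.log (∫ x, Real.exp ⟪t, x⟫ * p x)) h i j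
      = ∫ x, (x i - m i) * (x j - m j) * q x := fun i j => by
    have hmom₁ : ∀ k, L⁻¹ * ∫ x : EuclideanSpace ℝ (Fin d), x k * (Real.exp ⟪h, x⟫ * p x) = m k :=
      fun k => by
        rw [← integral_const_mul]
        exact integral_congr_ae (Eventually.of_forall fun x => by simp only [hq]; ring)
    have hmom₂ : L⁻¹ * ∫ x : EuclideanSpace ℝ (Fin d), x i * x j * (Real.exp ⟪h, x⟫ * p x)
        = ∫ x, x i * x j * q x := by
      rw [← integral_const_mul]
      exact integral_congr_ae (Eventually.of_forall fun x => by simp only [hq]; ring)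
    rw [integral_coord_sub_mean_mul hq0 hq1 hq2 (fun k => rfl) i j, hessMatrix,
      Matrix.of_apply, hHess]
    simp only [EuclideanSpace.inner_single_right, one_mul, conj_trivial]
    rw [hmom₁, hmom₁, hmom₂]
  have key := one_le_mul_sqrt_det_secondMoment hq0 hq1 hq2 hqM m hcov
  have hpi : (2 * π : ℝ) ^ (-(d : ℝ) / 2) * (2 * π) ^ ((d : ℝ) / 2) = 1 := by
    rw [← Real.rpow_add (by positivity), neg_div, neg_add_cancel, Real.rpow_zero]
  set D := √(hessMatrix (fun t => Real.log (∫ x, Real.exp ⟪t, x⟫ * p x)) h).det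
  have hc0 : 0 < c := by linarith
  calc 1 / c * Real.exp (-A h - (d : ℝ) / 2)
      ≤ 1 / c * Real.exp (-A h - (d : ℝ) / 2) * (c * (2 * π) ^ (-(d : ℝ) / 2) * Real.exp (A h)
        * Real.exp ((d : ℝ) / 2) * (2 * π) ^ ((d : ℝ) / 2) * D) :=
        le_mul_of_one_le_right (by positivity) key
    _ = (1 / c * c) * ((2 * π) ^ (-(d : ℝ) / 2) * (2 * π) ^ ((d : ℝ) / 2))
        * (Real.exp (-A h - (d : ℝ) / 2) * Real.exp (A h) * Real.exp ((d : ℝ) / 2)) * D := by ring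
    _ = D := by
        rw [hpi, ← Real.exp_add, ← Real.exp_add, one_div_mul_cancel hc0.ne']
        ring_nf
        simp
end

section
/- Let X be a sub-Gaussian random vector in ℝ^d with density p satisfying p(x) ≤ c φ(x) almost everywhere (c ≥ 1), and such that A(h) = |h|²/2 − K(h) ≥ 0 for all h ∈ ℝ^d, where K(h) = log E exp(⟨h,X⟩). Then for every h ∈ ℝ^d, the eigenvalues λ₁(h), ..., λ_d(h) of the Hessian K''(h) satisfy: (1/c²) · e^{−2A(h) − d} / (8A(h) + 2)^{d−1} ≤ min_j λ_j(h) ≤ max_j λ_j(h) ≤ 8 A(h) + 2. -/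
open MeasureTheory ProbabilityTheory Real Filter
open scoped ENNReal RealInnerProductSpace Topology

/-- Jensen's inequality for the exponential, with the exponential moment bounded as a lower
Lebesgue integral. -/
theorem exp_integral_le_of_lintegral_exp_le {Ω : Type*} [MeasurableSpace Ω] {ν : Measure Ω}
    [IsProbabilityMeasure ν] {Y : Ω → ℝ} (hY : Integrable Y ν) {B : ℝ} (hB : 0 ≤ B)
    (h : ∫⁻ ω, ENNReal.ofReal (exp (Y ω)) ∂ν ≤ ENNReal.ofReal B) :
    exp (∫ ω, Y ω ∂ν) ≤ B := by
  have hm : AEStronglyMeasurable (fun ω => exp (Y ω)) ν :=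
    continuous_exp.comp_aestronglyMeasurable hY.1
  have hint : Integrable (fun ω => exp (Y ω)) ν := by
    refine ⟨hm, ?_⟩
    rw [hasFiniteIntegral_iff_ofReal (ae_of_all _ fun ω => (exp_pos _).le)]
    exact h.trans_lt ENNReal.ofReal_lt_top
  refine (convexOn_exp.map_integral_le continuous_exp.continuousOn isClosed_univ
    (ae_of_all _ fun _ => Set.mem_univ _) hY hint).trans ?_
  change ∫ ω, exp (Y ω) ∂ν ≤ B
  rw [integral_eq_lintegral_of_nonneg_ae (ae_of_all _ fun ω => (exp_pos _).le) hm]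
  exact ENNReal.toReal_le_of_le_ofReal hB h

theorem lintegral_exp_sq_gaussianReal_half :
    ∫⁻ s, ENNReal.ofReal (exp (s ^ 2 / 2)) ∂(gaussianReal 0 (1 / 2)) = ENNReal.ofReal √2 := by
  rw [gaussianReal_of_var_ne_zero _ (by norm_num),
    lintegral_withDensity_eq_lintegral_mul _ (measurable_gaussianPDF _ _) (by fun_prop)]
  have hpt : ∀ s : ℝ, (gaussianPDF 0 (1 / 2) * fun s => ENNReal.ofReal (exp (s ^ 2 / 2))) s
      = ENNReal.ofReal ((√π)⁻¹ * exp (-(1 / 2) * s ^ 2)) := by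
    intro s
    rw [Pi.mul_apply, gaussianPDF, ← ENNReal.ofReal_mul (gaussianPDFReal_nonneg _ _ _),
      gaussianPDFReal]
    congr 1
    rw [mul_assoc, ← exp_add]
    congr 2
    · congr 1
      push_cast
      ring
    · push_cast
      ring
  simp_rw [hpt]
  rw [← ofReal_integral_eq_lintegral_ofReal
    ((integrable_exp_neg_mul_sq (by norm_num)).const_mul _) (ae_of_all _ fun s => by positivity),
    integral_const_mul, integral_gaussian]
  congr 1
  rw [div_div_eq_mul_div, div_one, Real.sqrt_mul pi_pos.le]
  field_simp

theorem integral_sq_le_of_integral_exp_le {Ω : Type*} [MeasurableSpace Ω] {ν : Measure Ω}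
    [IsProbabilityMeasure ν] {ξ : Ω → ℝ} (hξ : Measurable ξ) {A : ℝ}
    (hint : ∀ s : ℝ, Integrable (fun ω => exp (s * ξ ω)) ν)
    (hle : ∀ s : ℝ, ∫ ω, exp (s * ξ ω) ∂ν ≤ exp (s ^ 2 / 2 + A)) :
    ∫ ω, ξ ω ^ 2 ∂ν ≤ 4 * A + 2 * log 2 := by
  have hsq : Integrable (fun ω => ξ ω ^ 2) ν :=
    integrable_pow_of_integrable_exp_mul one_ne_zero (hint 1) (hint (-1)) 2
  have hbd : ∫⁻ ω, ENNReal.ofReal (exp (ξ ω ^ 2 / 4)) ∂ν ≤ ENNReal.ofReal (√2 * exp A) := by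
    calc ∫⁻ ω, ENNReal.ofReal (exp (ξ ω ^ 2 / 4)) ∂ν
        = ∫⁻ ω, ∫⁻ s, ENNReal.ofReal (exp (s * ξ ω)) ∂(gaussianReal 0 (1 / 2)) ∂ν := by
          refine lintegral_congr fun ω => ?_
          have hmgf := congrFun (mgf_id_gaussianReal (μ := 0) (v := 1 / 2)) (ξ ω)
          have hi := integrable_exp_mul_gaussianReal (μ := 0) (v := 1 / 2) (ξ ω)
          simp only [mgf, id] at hmgf
          simp_rw [mul_comm _ (ξ ω)]
          rw [← ofReal_integral_eq_lintegral_ofReal hi (ae_of_all _ fun s => (exp_pos _).le), hmgf]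
          congr 2
          push_cast
          ring
      _ = ∫⁻ s, ∫⁻ ω, ENNReal.ofReal (exp (s * ξ ω)) ∂ν ∂(gaussianReal 0 (1 / 2)) :=
          lintegral_lintegral_swap (by fun_prop)
      _ ≤ ∫⁻ s, ENNReal.ofReal (exp (s ^ 2 / 2)) * ENNReal.ofReal (exp A)
            ∂(gaussianReal 0 (1 / 2)) := by
          refine lintegral_mono fun s => ?_
          rw [← ofReal_integral_eq_lintegral_ofReal (hint s)
            (ae_of_all _ fun s => (exp_pos _).le), ← ENNReal.ofReal_mul (exp_pos _).le, ← exp_add]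
          exact ENNReal.ofReal_le_ofReal (hle s)
      _ = ENNReal.ofReal (√2 * exp A) := by
          rw [lintegral_mul_const _ (by fun_prop), lintegral_exp_sq_gaussianReal_half,
            ENNReal.ofReal_mul (by positivity)]
  have hJ := exp_integral_le_of_lintegral_exp_le (hsq.div_const 4) (by positivity) hbd
  rw [integral_div, ← le_log_iff_exp_le (by positivity),
    log_mul (by positivity) (exp_pos _).ne', log_exp, log_sqrt (by norm_num)] at hJ
  linarith

theorem integral_exp_neg_sum_sq_div {ι E : Type*} [Fintype ι] [NormedAddCommGroup E]
    [InnerProductSpace ℝ E] [FiniteDimensional ℝ E] [MeasurableSpace E] [BorelSpace E]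
    (b : OrthonormalBasis ι ℝ E) (m v : ι → ℝ) (hv : ∀ i, 0 < v i) :
    Integrable (fun x : E => exp (-∑ i, (⟪b i, x⟫ - m i) ^ 2 / (2 * v i))) ∧
      ∫ x : E, exp (-∑ i, (⟪b i, x⟫ - m i) ^ 2 / (2 * v i)) = ∏ i, √(2 * π * v i) := by
  have hmp : MeasurePreserving (fun x : E => (WithLp.ofLp (b.repr x) : ι → ℝ)) :=
    (PiLp.volume_preserving_ofLp ι).comp b.measurePreserving_repr
  have hme : MeasurableEmbedding (fun x : E => (WithLp.ofLp (b.repr x) : ι → ℝ)) :=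
    (MeasurableEquiv.toLp 2 (ι → ℝ)).symm.measurableEmbedding.comp
      b.measurableEquiv.measurableEmbedding
  have heq : (fun x : E => exp (-∑ i, (⟪b i, x⟫ - m i) ^ 2 / (2 * v i)))
      = (fun y : ι → ℝ => ∏ i, exp (-(1 / (2 * v i)) * (y i - m i) ^ 2)) ∘
        (fun x : E => (WithLp.ofLp (b.repr x) : ι → ℝ)) := by
    funext x
    simp only [Function.comp, b.repr_apply_apply]
    rw [← Finset.sum_neg_distrib, exp_sum]
    refine Finset.prod_congr rfl fun i _ => ?_
    congr 1
    ring
  rw [heq]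
  constructor
  · rw [hmp.integrable_comp_emb hme]
    refine Integrable.fintype_prod (f := fun i y => exp (-(1 / (2 * v i)) * (y - m i) ^ 2))
      fun i => ?_
    have := hv i
    exact (integrable_exp_neg_mul_sq (b := 1 / (2 * v i)) (by positivity)).comp_sub_right (m i)
  · have h1 := hmp.integral_comp hme
      (fun y : ι → ℝ => ∏ i, exp (-(1 / (2 * v i)) * (y i - m i) ^ 2))
    refine h1.trans ?_
    rw [integral_fintype_prod_volume_eq_prod
      (fun i (y : ℝ) => exp (-(1 / (2 * v i)) * (y - m i) ^ 2))]
    refine Finset.prod_congr rfl fun i _ => ?_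
    rw [integral_sub_right_eq_self (fun y : ℝ => exp (-(1 / (2 * v i)) * y ^ 2)) (m i),
      integral_gaussian]
    congr 1
    rw [div_div_eq_mul_div, div_one]
    ring

/-- A maximum-entropy bound: a probability measure with density at most `M`, whose variance along
the `i`-th vector of an orthonormal basis is at most `v i`, satisfies a lower bound for
`∏ i, v i`. -/
theorem exp_neg_card_half_le_mul_prod {ι E : Type*} [Fintype ι] [NormedAddCommGroup E]
    [InnerProductSpace ℝ E] [FiniteDimensional ℝ E] [MeasurableSpace E] [BorelSpace E]
    (b : OrthonormalBasis ι ℝ E) (ν : Measure E) [IsProbabilityMeasure ν] {M : ℝ} (hM : 0 ≤ M)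
    (hν : ν ≤ ENNReal.ofReal M • volume) (hL : ∀ i, MemLp (fun x => ⟪b i, x⟫) 2 ν)
    (v : ι → ℝ) (hv : ∀ i, 0 < v i) (hvar : ∀ i, Var[fun x => ⟪b i, x⟫; ν] ≤ v i) :
    exp (-(Fintype.card ι : ℝ) / 2) ≤ M * ∏ i, √(2 * π * v i) := by
  set m : ι → ℝ := fun i => ∫ x, ⟪b i, x⟫ ∂ν with hm
  obtain ⟨hint, hval⟩ := integral_exp_neg_sum_sq_div b m v hv
  have hsq : ∀ i, Integrable (fun x => (⟪b i, x⟫ - m i) ^ 2 / (2 * v i)) ν := fun i =>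
    (((hL i).sub (memLp_const (m i))).integrable_sq).div_const _
  have hbd : ∫⁻ x, ENNReal.ofReal (exp (-∑ i, (⟪b i, x⟫ - m i) ^ 2 / (2 * v i))) ∂ν
      ≤ ENNReal.ofReal (M * ∏ i, √(2 * π * v i)) := by
    refine (lintegral_mono' hν le_rfl).trans ?_
    rw [lintegral_smul_measure, ← ofReal_integral_eq_lintegral_ofReal hint
      (ae_of_all _ fun s => (exp_pos _).le), hval, ENNReal.ofReal_mul hM, smul_eq_mul]
  have hJ := exp_integral_le_of_lintegral_exp_le
    (integrable_finsetSum Finset.univ fun i _ => hsq i).neg (by positivity) hbd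
  refine le_trans (exp_le_exp.2 ?_) hJ
  simp only [Pi.neg_apply]
  rw [integral_neg, integral_finsetSum _ fun i _ => hsq i, neg_div]
  refine neg_le_neg ?_
  calc ∑ i, ∫ x, (⟪b i, x⟫ - m i) ^ 2 / (2 * v i) ∂ν ≤ ∑ _i : ι, (1 / 2 : ℝ) := by
        refine Finset.sum_le_sum fun i _ => ?_
        rw [integral_div, ← variance_eq_integral (hL i).aestronglyMeasurable.aemeasurable,
          div_le_iff₀ (by have := hv i; positivity)]
        linarith [hvar i]
    _ = (Fintype.card ι : ℝ) / 2 := by simp [div_eq_mul_inv]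

theorem aestronglyMeasurable_innerSL_smulRight_s16 {E G : Type*} [NormedAddCommGroup E]
    [InnerProductSpace ℝ E] [FiniteDimensional ℝ E] [MeasurableSpace E] [BorelSpace E]
    [NormedAddCommGroup G] [NormedSpace ℝ G] {μ : Measure E} {F : E → G}
    (hF : AEStronglyMeasurable F μ) :
    AEStronglyMeasurable (fun x => (innerSL ℝ x).smulRight (F x)) μ := by
  have hc : Continuous fun q : E × G => (innerSL ℝ q.1).smulRight q.2 :=
    (ContinuousLinearMap.smulRightL ℝ E G).continuous₂.comp
      (((innerSL ℝ).continuous.comp continuous_fst).prodMk continuous_snd)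
  exact hc.comp_aestronglyMeasurable (aestronglyMeasurable_id.prodMk hF)

theorem integrable_exp_norm_mul_norm_smulRight {E G : Type*} [NormedAddCommGroup E]
    [InnerProductSpace ℝ E] [FiniteDimensional ℝ E] [MeasurableSpace E] [BorelSpace E]
    [NormedAddCommGroup G] [NormedSpace ℝ G] {μ : Measure E} {F : E → G}
    (hF : AEStronglyMeasurable F μ)
    (hint : ∀ a : ℝ, Integrable (fun x => exp (a * ‖x‖) * ‖F x‖) μ) (a : ℝ) :
    Integrable (fun x => exp (a * ‖x‖) * ‖(innerSL ℝ x).smulRight (F x)‖) μ := by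
  refine (hint (a + 1)).mono'
    ((by fun_prop : Continuous fun x : E => exp (a * ‖x‖)).aestronglyMeasurable.mul
      (aestronglyMeasurable_innerSL_smulRight_s16 hF).norm) (ae_of_all _ fun x => ?_)
  rw [norm_of_nonneg (by positivity), ContinuousLinearMap.norm_smulRight_apply,
    innerSL_apply_norm, ← mul_assoc, add_mul, one_mul, exp_add]
  gcongr
  linarith [add_one_le_exp ‖x‖]

theorem integrable_exp_inner_smul_s16 {E G : Type*} [NormedAddCommGroup E]
    [InnerProductSpace ℝ E] [FiniteDimensional ℝ E] [MeasurableSpace E] [BorelSpace E]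
    [NormedAddCommGroup G] [NormedSpace ℝ G] {μ : Measure E} {F : E → G}
    (hF : AEStronglyMeasurable F μ)
    (hint : ∀ a : ℝ, Integrable (fun x => exp (a * ‖x‖) * ‖F x‖) μ) (t : E) :
    Integrable (fun x => exp ⟪t, x⟫ • F x) μ := by
  refine (hint ‖t‖).mono' ((by fun_prop :
    Continuous fun x : E => exp ⟪t, x⟫).aestronglyMeasurable.smul hF) (ae_of_all _ fun x => ?_)
  rw [norm_smul, norm_of_nonneg (exp_pos _).le]
  gcongr
  exact real_inner_le_norm t x

theorem hasFDerivAt_integral_exp_inner_smul_s16 {E G : Type*} [NormedAddCommGroup E]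
    [InnerProductSpace ℝ E] [FiniteDimensional ℝ E] [MeasurableSpace E] [BorelSpace E]
    [NormedAddCommGroup G] [NormedSpace ℝ G] {μ : Measure E} {F : E → G}
    (hF : AEStronglyMeasurable F μ)
    (hint : ∀ a : ℝ, Integrable (fun x => exp (a * ‖x‖) * ‖F x‖) μ) (t : E) :
    HasFDerivAt (fun t => ∫ x, exp ⟪t, x⟫ • F x ∂μ)
      (∫ x, exp ⟪t, x⟫ • (innerSL ℝ x).smulRight (F x) ∂μ) t := by
  have hexp : ∀ s : E, AEStronglyMeasurable (fun x : E => exp ⟪s, x⟫) μ := fun s =>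
    (by fun_prop : Continuous fun x : E => exp ⟪s, x⟫).aestronglyMeasurable
  refine hasFDerivAt_integral_of_dominated_of_fderiv_le
    (F' := fun t x => exp ⟪t, x⟫ • (innerSL ℝ x).smulRight (F x))
    (bound := fun x => exp ((‖t‖ + 2) * ‖x‖) * ‖F x‖)
    (Metric.ball_mem_nhds t one_pos) (Eventually.of_forall fun s => (hexp s).smul hF)
    (integrable_exp_inner_smul_s16 hF hint t) ?_ ?_ (hint _) ?_
  · exact (hexp t).smul (aestronglyMeasurable_innerSL_smulRight_s16 hF)
  · refine ae_of_all _ fun x s hs => ?_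
    rw [norm_smul, norm_of_nonneg (exp_pos _).le, ContinuousLinearMap.norm_smulRight_apply,
      innerSL_apply_norm, ← mul_assoc]
    refine mul_le_mul_of_nonneg_right ?_ (norm_nonneg _)
    have hs' : ‖s‖ ≤ ‖t‖ + 1 := by
      have := norm_le_norm_add_norm_sub' s t
      rw [Metric.mem_ball, dist_eq_norm] at hs
      linarith
    calc exp ⟪s, x⟫ * ‖x‖ ≤ exp ((‖t‖ + 1) * ‖x‖) * exp ‖x‖ := by
          gcongr
          · exact (real_inner_le_norm s x).trans (by gcongr)
          · linarith [add_one_le_exp ‖x‖]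
      _ = exp ((‖t‖ + 2) * ‖x‖) := by rw [← exp_add]; ring_nf
  · refine ae_of_all _ fun x s _ => ?_
    have h1 : HasFDerivAt (fun s : E => ⟪s, x⟫) (innerSL ℝ x) s := by
      have := (innerSL ℝ x).hasFDerivAt (x := s)
      simpa [real_inner_comm] using this
    convert (h1.exp).smul_const (F x) using 1
    ext y
    simp [smul_smul]

theorem integrable_exp_inner {E : Type*} [NormedAddCommGroup E]
    [InnerProductSpace ℝ E] [FiniteDimensional ℝ E] [MeasurableSpace E] [BorelSpace E]
    {μ : Measure E} (hint : ∀ a : ℝ, Integrable (fun x => exp (a * ‖x‖)) μ) (t : E) :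
    Integrable (fun x => exp ⟪t, x⟫) μ := by
  simpa using integrable_exp_inner_smul_s16 (F := fun _ : E => (1 : ℝ))
    aestronglyMeasurable_const (by simpa using hint) t

theorem integrable_exp_mul_inner_tilted {E : Type*} [NormedAddCommGroup E]
    [InnerProductSpace ℝ E] [FiniteDimensional ℝ E] [MeasurableSpace E] [BorelSpace E]
    {μ : Measure E} (hint : ∀ a : ℝ, Integrable (fun x => exp (a * ‖x‖)) μ) (h θ : E) (s : ℝ) :
    Integrable (fun x => exp (s * ⟪θ, x⟫)) (μ.tilted fun x => ⟪h, x⟫) := by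
  rw [integrable_tilted_iff (integrable_exp_inner hint h)]
  convert integrable_exp_inner hint (h + s • θ) using 2 with x
  rw [smul_eq_mul, ← exp_add, inner_add_left, real_inner_smul_left]

theorem memLp_two_inner_tilted {E : Type*} [NormedAddCommGroup E]
    [InnerProductSpace ℝ E] [FiniteDimensional ℝ E] [MeasurableSpace E] [BorelSpace E]
    {μ : Measure E} (hint : ∀ a : ℝ, Integrable (fun x => exp (a * ‖x‖)) μ) (h θ : E) :
    MemLp (fun x => ⟪θ, x⟫) 2 (μ.tilted fun x => ⟪h, x⟫) := by
  rw [memLp_two_iff_integrable_sq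
    (by fun_prop : Continuous fun x : E => ⟪θ, x⟫).aestronglyMeasurable]
  exact integrable_pow_of_integrable_exp_mul one_ne_zero
    (integrable_exp_mul_inner_tilted hint h θ 1) (integrable_exp_mul_inner_tilted hint h θ (-1)) 2

/-- The Hessian of the log-Laplace transform of `μ` at `h` is the covariance form of the
exponentially tilted measure. -/
theorem iteratedFDeriv_two_log_integral_exp_inner_s16 {E : Type*} [NormedAddCommGroup E]
    [InnerProductSpace ℝ E] [FiniteDimensional ℝ E] [MeasurableSpace E] [BorelSpace E]
    {μ : Measure E} [NeZero μ] (hint : ∀ a : ℝ, Integrable (fun x => exp (a * ‖x‖)) μ)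
    (h θ : E) :
    iteratedFDeriv ℝ 2 (fun t => log (∫ x, exp ⟪t, x⟫ ∂μ)) h ![θ, θ]
      = Var[fun x => ⟪θ, x⟫; μ.tilted fun x => ⟪h, x⟫] := by
  have hpos : ∀ t : E, 0 < ∫ x, exp ⟪t, x⟫ ∂μ := fun t =>
    integral_exp_pos (integrable_exp_inner hint t)
  have hone : ∀ x : E, (innerSL ℝ x).smulRight (1 : ℝ) = innerSL ℝ x := fun x => by
    ext y; simp
  have hm0 : AEStronglyMeasurable (fun _ : E => (1 : ℝ)) μ := aestronglyMeasurable_const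
  have hi0 : ∀ a : ℝ, Integrable (fun x : E => exp (a * ‖x‖) * ‖(1 : ℝ)‖) μ := by simpa using hint
  have hm1 := aestronglyMeasurable_innerSL_smulRight_s16 hm0
  have hi1 := integrable_exp_norm_mul_norm_smulRight hm0 hi0
  have hd0 := hasFDerivAt_integral_exp_inner_smul_s16 hm0 hi0
  simp only [hone] at hm1 hi1 hd0
  simp only [smul_eq_mul, mul_one] at hd0
  have hd1 := hasFDerivAt_integral_exp_inner_smul_s16 hm1 hi1 h
  have hi2 := integrable_exp_inner_smul_s16 (aestronglyMeasurable_innerSL_smulRight_s16 hm1)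
    (integrable_exp_norm_mul_norm_smulRight hm1 hi1) h
  have hI1 := integrable_exp_inner_smul_s16 hm1 hi1 h
  have hfd : fderiv ℝ (fun t => log (∫ x, exp ⟪t, x⟫ ∂μ))
      = fun t => (∫ x, exp ⟪t, x⟫ ∂μ)⁻¹ • ∫ x, exp ⟪t, x⟫ • innerSL ℝ x ∂μ :=
    funext fun t => ((hd0 t).log (hpos t).ne').fderiv
  have hinv : HasFDerivAt (fun t => (∫ x, exp ⟪t, x⟫ ∂μ)⁻¹)
      (-((∫ x, exp ⟪h, x⟫ ∂μ) ^ 2)⁻¹ • ∫ x, exp ⟪h, x⟫ • innerSL ℝ x ∂μ) h :=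
    (hasDerivAt_inv (hpos h).ne').comp_hasFDerivAt h (hd0 h)
  have hsmul := hinv.smul hd1
  have hE1 : (∫ x, exp ⟪h, x⟫ • innerSL ℝ x ∂μ) θ = ∫ x, exp ⟪h, x⟫ * ⟪θ, x⟫ ∂μ := by
    rw [ContinuousLinearMap.integral_apply hI1]
    simp [real_inner_comm]
  have hE2 : (∫ x, exp ⟪h, x⟫ • (innerSL ℝ x).smulRight (innerSL ℝ x) ∂μ) θ θ
      = ∫ x, exp ⟪h, x⟫ * ⟪θ, x⟫ ^ 2 ∂μ := by
    rw [ContinuousLinearMap.integral_apply hi2, ContinuousLinearMap.integral_apply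
      (hi2.apply_continuousLinearMap θ)]
    simp [real_inner_comm, sq]
  have := isProbabilityMeasure_tilted (integrable_exp_inner hint h)
  rw [iteratedFDeriv_two_apply, hfd]
  simp only [Matrix.cons_val_zero, Matrix.cons_val_one]
  erw [hsmul.fderiv]
  simp only [_root_.add_apply, _root_.smul_apply,
    ContinuousLinearMap.smulRight_apply, smul_eq_mul, hE1, hE2]
  rw [variance_eq_sub (memLp_two_inner_tilted hint h θ), integral_tilted, integral_tilted]
  simp only [Pi.pow_apply, smul_eq_mul, div_mul_eq_mul_div, integral_div]
  have := (hpos h).ne'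
  field_simp
  ring

theorem integrable_exp_norm_of_integrable_exp_sq {E : Type*} [NormedAddCommGroup E]
    [MeasurableSpace E] [BorelSpace E] {μ : Measure E} {c : ℝ} (hc : 0 < c)
    (hint : Integrable (fun x => exp (c * ‖x‖ ^ 2)) μ) (a : ℝ) :
    Integrable (fun x => exp (a * ‖x‖)) μ := by
  refine (hint.const_mul (exp (a ^ 2 / (4 * c)))).mono'
    (by fun_prop : Measurable fun x : E => exp (a * ‖x‖)).aestronglyMeasurable
    (ae_of_all _ fun x => ?_)
  rw [norm_of_nonneg (exp_pos _).le, ← exp_add, exp_le_exp]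
  have h : a ^ 2 / (4 * c) + c * ‖x‖ ^ 2 - a * ‖x‖ = (a - 2 * c * ‖x‖) ^ 2 / (4 * c) := by
    field_simp
    ring
  have : 0 ≤ (a - 2 * c * ‖x‖) ^ 2 / (4 * c) := by positivity
  linarith

/-- A covariance lower bound in one direction, given variance bounds in all directions and a
bound on the density. -/
theorem exp_neg_le_sq_mul_variance_mul_pow {E : Type*} [NormedAddCommGroup E]
    [InnerProductSpace ℝ E] [FiniteDimensional ℝ E] [MeasurableSpace E] [BorelSpace E] {d : ℕ}
    (hd : 1 ≤ d) (hdim : Module.finrank ℝ E = d) (ν : Measure E) [IsProbabilityMeasure ν]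
    {M : ℝ} (hM : 0 ≤ M) (hν : ν ≤ ENNReal.ofReal M • volume)
    (hL : ∀ θ : E, MemLp (fun x => ⟪θ, x⟫) 2 ν) {B : ℝ} (hB : 0 < B)
    (hvar : ∀ θ : E, ‖θ‖ = 1 → Var[fun x => ⟪θ, x⟫; ν] ≤ B) (θ : E) (hθ : ‖θ‖ = 1) :
    exp (-(d : ℝ)) ≤ M ^ 2 * (2 * π) ^ d * (Var[fun x => ⟪θ, x⟫; ν] * B ^ (d - 1)) := by
  let i₀ : Fin d := ⟨0, hd⟩
  have horth : Orthonormal ℝ (({i₀} : Set (Fin d)).domRestrict fun _ => θ) :=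
    ⟨fun _ => hθ, fun i j hij => absurd (Subsingleton.elim i j) hij⟩
  obtain ⟨b, hb⟩ := horth.exists_orthonormalBasis_extension_of_card_eq (by simpa using hdim)
  have hb0 : b i₀ = θ := hb i₀ rfl
  have key : ∀ a, Var[fun x => ⟪θ, x⟫; ν] < a →
      exp (-(d : ℝ)) / (M ^ 2 * (2 * π) ^ d * B ^ (d - 1)) ≤ a := by
    intro a ha
    have ha0 : 0 < a := (variance_nonneg _ _).trans_lt ha
    have hmain := exp_neg_card_half_le_mul_prod b ν hM hν (fun i => hL (b i))
      (Function.update (fun _ => B) i₀ a)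
      (fun i => by
        rcases eq_or_ne i i₀ with rfl | hi
        · simpa using ha0
        · simpa [hi] using hB)
      (fun i => by
        rcases eq_or_ne i i₀ with rfl | hi
        · simpa [hb0] using ha.le
        · simpa [hi] using hvar _ (b.orthonormal.1 i))
    have hv : ∀ i, 0 ≤ 2 * π * Function.update (fun _ => B) i₀ a i := fun i => by
      rcases eq_or_ne i i₀ with rfl | hi
      · simp only [Function.update_self]; positivity
      · simp only [Function.update_of_ne hi]; positivity
    have hsq := pow_le_pow_left₀ (exp_pos _).le hmain 2
    rw [← exp_nat_mul, mul_pow, ← Finset.prod_pow,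
      Finset.prod_congr rfl fun i _ => sq_sqrt (hv i), Finset.prod_mul_distrib,
      Finset.prod_update_of_mem (Finset.mem_univ _), Finset.prod_const, Finset.prod_const,
      Finset.card_sdiff_of_subset (Finset.subset_univ _)] at hsq
    simp only [Fintype.card_fin, Finset.card_univ, Finset.card_singleton] at hsq
    have hlhs : ((2 : ℕ) : ℝ) * (-(d : ℝ) / 2) = -d := by push_cast; ring
    rw [hlhs] at hsq
    have hMpos : 0 < M := by
      refine hM.lt_of_ne fun h0 => ?_
      rw [← h0] at hsq
      simp only [ne_eq, OfNat.ofNat_ne_zero, not_false_eq_true, zero_pow, zero_mul] at hsq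
      exact absurd hsq (not_le.2 (exp_pos _))
    rw [div_le_iff₀ (by positivity)]
    linarith
  have hle := le_of_forall_gt_imp_ge_of_dense key
  by_cases hMz : M = 0
  · have : ν = 0 := by
      rw [← Measure.nonpos_iff_eq_zero']
      simpa [hMz] using hν
    exact absurd this (IsProbabilityMeasure.ne_zero ν)
  · have hMpos : 0 < M := hM.lt_of_ne' hMz
    rw [div_le_iff₀ (by positivity)] at hle
    linarith

theorem stmt16 {d : ℕ} (hd : 1 ≤ d)
    (p : EuclideanSpace ℝ (Fin d) → ℝ)
    (hpm : Measurable p) (hp0 : ∀ x, 0 ≤ p x)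
    (hp1 : ∫ x, p x = 1)
    (hsubG : ∃ c > 0, Integrable (fun x => Real.exp (c * ‖x‖ ^ 2) * p x))
    (c : ℝ) (hc : 1 ≤ c)
    (hbound : ∀ᵐ x ∂(volume : Measure (EuclideanSpace ℝ (Fin d))),
      p x ≤ c * gaussPDF d x)
    (K A : EuclideanSpace ℝ (Fin d) → ℝ)
    (hK : ∀ t, K t = Real.log (∫ x, Real.exp ⟪t, x⟫ * p x))
    (hA : ∀ t, A t = ‖t‖ ^ 2 / 2 - K t)
    -- strict sub-Gaussianity: A ≥ 0
    (hA0 : ∀ h, 0 ≤ A h)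
    (h : EuclideanSpace ℝ (Fin d)) :
    ∀ θ : EuclideanSpace ℝ (Fin d), ‖θ‖ = 1 →
      (1 / c ^ 2) * (Real.exp (-2 * A h - (d : ℝ)) / (8 * A h + 2) ^ (d - 1))
          ≤ iteratedFDeriv ℝ 2 K h ![θ, θ] ∧
        iteratedFDeriv ℝ 2 K h ![θ, θ] ≤ 8 * A h + 2 := by
  obtain ⟨c₀, hc₀, hsub⟩ := hsubG
  have hpm' : Measurable fun x => ENNReal.ofReal (p x) := hpm.ennreal_ofReal
  set μ : Measure (EuclideanSpace ℝ (Fin d)) :=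
    volume.withDensity fun x => ENNReal.ofReal (p x) with hμ
  have hμint : ∀ g : EuclideanSpace ℝ (Fin d) → ℝ, ∫ x, g x ∂μ = ∫ x, g x * p x := fun g => by
    rw [hμ, integral_withDensity_eq_integral_toReal_smul hpm'
      (ae_of_all _ fun _ => ENNReal.ofReal_lt_top)]
    simp [ENNReal.toReal_ofReal (hp0 _), mul_comm]
  have hp_int : Integrable p := Integrable.of_integral_ne_zero (by rw [hp1]; exact one_ne_zero)
  have hμprob : IsProbabilityMeasure μ := ⟨by
    rw [hμ, withDensity_apply _ MeasurableSet.univ, setLIntegral_univ,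
      ← ofReal_integral_eq_lintegral_ofReal hp_int (ae_of_all _ hp0), hp1, ENNReal.ofReal_one]⟩
  have hint : ∀ a : ℝ, Integrable (fun x => exp (a * ‖x‖)) μ := by
    refine integrable_exp_norm_of_integrable_exp_sq hc₀ ?_
    rw [hμ, integrable_withDensity_iff hpm' (ae_of_all _ fun _ => ENNReal.ofReal_lt_top)]
    simpa [ENNReal.toReal_ofReal (hp0 _)] using hsub
  have hKμ : K = fun t => log (∫ x, exp ⟪t, x⟫ ∂μ) := funext fun t => by rw [hK, hμint]
  have hL : ∀ t, ∫ x, exp ⟪t, x⟫ ∂μ = exp (‖t‖ ^ 2 / 2 - A t) := fun t => by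
    rw [hA, sub_sub_cancel, hKμ, exp_log (integral_exp_pos (integrable_exp_inner hint t))]
  have hνprob := isProbabilityMeasure_tilted (integrable_exp_inner hint h)
  set ν := μ.tilted fun x => ⟪h, x⟫ with hν
  have hupper : ∀ θ : EuclideanSpace ℝ (Fin d), ‖θ‖ = 1 →
      Var[fun x => ⟪θ, x⟫; ν] ≤ 8 * A h + 2 := by
    intro θ hθ
    have hmeas : Measurable fun x : EuclideanSpace ℝ (Fin d) => ⟪θ, x⟫ - ⟪θ, h⟫ := by fun_prop
    have hrw : ∀ s : ℝ, (fun x => exp (s * (⟪θ, x⟫ - ⟪θ, h⟫)))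
        = fun x => exp (-(s * ⟪θ, h⟫)) * exp (s * ⟪θ, x⟫) := fun s => by
      funext x
      rw [← exp_add]
      ring_nf
    have hbound2 := integral_sq_le_of_integral_exp_le (A := A h) hmeas
      (fun s => by
        rw [hrw]
        exact (integrable_exp_mul_inner_tilted hint h θ s).const_mul _)
      (fun s => by
        have htilt : ∀ x, (exp ⟪h, x⟫ / ∫ x, exp ⟪h, x⟫ ∂μ) • exp (s * ⟪θ, x⟫)
            = exp ⟪h + s • θ, x⟫ / ∫ x, exp ⟪h, x⟫ ∂μ := fun x => by
          rw [inner_add_left, real_inner_smul_left, exp_add, smul_eq_mul]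
          ring
        rw [hrw, integral_const_mul, integral_tilted]
        simp_rw [htilt]
        rw [integral_div, hL, hL, ← exp_sub, ← exp_add, exp_le_exp, norm_add_sq_real,
          norm_smul, hθ, real_inner_smul_right, real_inner_comm h θ, mul_one, norm_eq_abs, sq_abs]
        linarith [hA0 (h + s • θ)])
    have hlog := log_two_lt_d9
    calc Var[fun x => ⟪θ, x⟫; ν] = Var[fun x => ⟪θ, x⟫ - ⟪θ, h⟫; ν] :=
          (variance_sub_const (by fun_prop) _).symm
      _ ≤ ∫ x, (⟪θ, x⟫ - ⟪θ, h⟫) ^ 2 ∂ν := variance_le_expectation_sq hmeas.aestronglyMeasurable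
      _ ≤ 8 * A h + 2 := by linarith [hA0 h]
  set M : ℝ := c * exp (A h) * (2 * π) ^ (-(d : ℝ) / 2) with hM
  have hνM : ν ≤ ENNReal.ofReal M • volume := by
    rw [hν, Measure.tilted, hμ, ← withDensity_mul _ hpm' (by fun_prop), ← withDensity_const]
    refine withDensity_mono ?_
    filter_upwards [hbound] with x hx
    rw [Pi.mul_apply, ← ENNReal.ofReal_mul (hp0 x)]
    refine ENNReal.ofReal_le_ofReal ?_
    rw [← hμ, hL, ← exp_sub]
    calc p x * exp (⟪h, x⟫ - (‖h‖ ^ 2 / 2 - A h))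
        ≤ c * gaussPDF d x * exp (⟪h, x⟫ - (‖h‖ ^ 2 / 2 - A h)) := by gcongr
      _ = M * exp (-‖x - h‖ ^ 2 / 2) := by
        have hexp : exp (-‖x‖ ^ 2 / 2) * exp (⟪h, x⟫ - (‖h‖ ^ 2 / 2 - A h))
            = exp (A h) * exp (-‖x - h‖ ^ 2 / 2) := by
          rw [← exp_add, ← exp_add, norm_sub_sq_real, real_inner_comm h x]
          ring_nf
        rw [gaussPDF, hM]
        linear_combination c * (2 * π) ^ (-(d : ℝ) / 2) * hexp
      _ ≤ M := mul_le_of_le_one_right (by positivity)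
        (exp_le_one_iff.2 (by have := sq_nonneg ‖x - h‖; linarith))
  have hM2 : M ^ 2 * (2 * π) ^ d = c ^ 2 * exp (2 * A h) := by
    have h1 : ((2 * π) ^ (-(d : ℝ) / 2)) ^ 2 * (2 * π) ^ d = 1 := by
      rw [← rpow_natCast, ← rpow_natCast, ← rpow_mul (by positivity), ← rpow_add (by positivity)]
      convert rpow_zero (2 * π) using 2
      push_cast
      ring
    have h2 : exp (2 * A h) = exp (A h) ^ 2 := by rw [← exp_nat_mul]; norm_num
    rw [hM, h2]
    linear_combination c ^ 2 * exp (A h) ^ 2 * h1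
  have hB : 0 < 8 * A h + 2 := by linarith [hA0 h]
  intro θ hθ
  rw [hKμ, iteratedFDeriv_two_log_integral_exp_inner_s16 hint]
  refine ⟨?_, hupper θ hθ⟩
  have hlow := exp_neg_le_sq_mul_variance_mul_pow hd (by simp) ν (by positivity) hνM
    (memLp_two_inner_tilted hint h) hB hupper θ hθ
  rw [hM2] at hlow
  have hexp : exp (-2 * A h - d) * exp (2 * A h) = exp (-(d : ℝ)) := by
    rw [← exp_add]
    ring_nf
  rw [one_div_mul_eq_div, div_div, div_le_iff₀ (by positivity)]
  refine le_of_mul_le_mul_right ?_ (exp_pos (2 * A h))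
  rw [hexp]
  linarith
end
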